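/- arXiv:2206.13877 — 3 statements merged into one kernel-verified Lean document; each statement's English description precedes it below -/
import Mathlib

section
/- For n ≥ 2, the number of reverse alternating involutions of length 2n avoiding the pattern 1234 equals M_{n+1} − 2M_{n−1} + M_{n−3}, where M_k is the k-th Motzkin number (with M_{−1} interpreted as 0 when n = 2). -/
/-- A permutation is an involution if it equals its inverse. -/
def IsInvolution {n : ℕ} (π : Equiv.Perm (Fin n)) : Prop :=
  ∀ i, π (π i) = i

/-- `π` is alternating: `π i < π (i+1)` iff `i` is odd (1-based positions). -/
def IsAlternating {n : ℕ} (π : Equiv.Perm (Fin n)) : Prop :=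
  ∀ (i : Fin n) (h : (i : ℕ) + 1 < n), (π i < π ⟨(i : ℕ) + 1, h⟩ ↔ Odd ((i : ℕ) + 1))

/-- `π` is reverse alternating: `π i > π (i+1)` iff `i` is odd (1-based positions). -/
def IsRevAlternating {n : ℕ} (π : Equiv.Perm (Fin n)) : Prop :=
  ∀ (i : Fin n) (h : (i : ℕ) + 1 < n), (π ⟨(i : ℕ) + 1, h⟩ < π i ↔ Odd ((i : ℕ) + 1))

/-- `σ` contains the pattern `τ`. -/
def Contains {n k : ℕ} (σ : Equiv.Perm (Fin n)) (τ : Equiv.Perm (Fin k)) : Prop :=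
  ∃ f : Fin k → Fin n, StrictMono f ∧ ∀ a b : Fin k, σ (f a) < σ (f b) ↔ τ a < τ b

/-- `σ` avoids the pattern `τ`. -/
def Avoids {n k : ℕ} (σ : Equiv.Perm (Fin n)) (τ : Equiv.Perm (Fin k)) : Prop :=
  ¬ Contains σ τ
def p123 : Equiv.Perm (Fin 3) := ⟨![0,1,2], ![0,1,2], by decide, by decide⟩
def p132 : Equiv.Perm (Fin 3) := ⟨![0,2,1], ![0,2,1], by decide, by decide⟩
def p321 : Equiv.Perm (Fin 3) := ⟨![2,1,0], ![2,1,0], by decide, by decide⟩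
def p1234 : Equiv.Perm (Fin 4) := ⟨![0,1,2,3], ![0,1,2,3], by decide, by decide⟩
def p4321 : Equiv.Perm (Fin 4) := ⟨![3,2,1,0], ![3,2,1,0], by decide, by decide⟩
def p3412 : Equiv.Perm (Fin 4) := ⟨![2,3,0,1], ![2,3,0,1], by decide, by decide⟩
def p3421 : Equiv.Perm (Fin 4) := ⟨![2,3,1,0], ![3,2,0,1], by decide, by decide⟩
def p4312 : Equiv.Perm (Fin 4) := ⟨![3,2,0,1], ![2,3,1,0], by decide, by decide⟩
def p2431 : Equiv.Perm (Fin 4) := ⟨![1,3,2,0], ![3,0,2,1], by decide, by decide⟩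
def p4132 : Equiv.Perm (Fin 4) := ⟨![3,0,2,1], ![1,3,2,0], by decide, by decide⟩

/-- Edge labels of the symmetric growth diagram of an involution `p` of `ℕ`. -/
def gw (p : ℕ → ℕ) : ℕ → ℕ → ℕ
  | _, 0 => 0
  | i, j + 1 =>
    if gw p i j = gw p j i then
      (if gw p i j = 0 then (if p i = j then 1 else 0) else gw p i j + 1)
    else gw p i j
termination_by i j => i + j

theorem gw_zero (p : ℕ → ℕ) (i : ℕ) : gw p i 0 = 0 := by
  rw [gw]

theorem gw_succ (p : ℕ → ℕ) (i j : ℕ) : gw p i (j + 1) =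
    if gw p i j = gw p j i then
      (if gw p i j = 0 then (if p i = j then 1 else 0) else gw p i j + 1)
    else gw p i j := by
  rw [gw]

theorem gw_eq_zero_iff (p : ℕ → ℕ) (hp : ∀ i, p (p i) = i) :
    ∀ s i j, i + j = s → (gw p i j = 0 ↔ j ≤ p i) := by
  intro s
  induction s using Nat.strong_induction_on with
  | _ s ih =>
    intro i j hs
    cases j with
    | zero => simp [gw_zero]
    | succ j =>
      have h1 := ih (i + j) (by omega) i j rfl
      have h2 := ih (j + i) (by omega) j i rfl
      have h3 : p i = j ↔ p j = i := by
        constructor <;> intro h <;> rw [← h, hp]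
      rw [gw_succ]
      generalize gw p i j = a at *
      generalize gw p j i = v at *
      split_ifs with ha hb hc
      · simp only [false_iff]; omega
      · subst ha
        constructor
        · omega
        · omega
      · simp only [false_iff]; omega
      · constructor
        · intro h4
          have h5 := h1.1 h4
          have h6 : ¬ (i ≤ p j) := fun h => ha (by rw [h4, h2.2 h])
          omega
        · omega

theorem gw_pos_iff (p : ℕ → ℕ) (hp : ∀ i, p (p i) = i) (i j : ℕ) :
    gw p i j = 0 ↔ j ≤ p i := gw_eq_zero_iff p hp _ i j rfl

/-- Row lengths of the shapes of the growth diagram. -/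
def gL (p : ℕ → ℕ) (k i j : ℕ) : ℕ := Nat.count (fun s => gw p s j = k) i

theorem gL_zero (p : ℕ → ℕ) (k j : ℕ) : gL p k 0 j = 0 := by simp [gL]

theorem gL_succ (p : ℕ → ℕ) (k i j : ℕ) :
    gL p k (i + 1) j = gL p k i j + if gw p i j = k then 1 else 0 := by
  simp [gL, Nat.count_succ]

theorem gL_zero' (p : ℕ → ℕ) (k i : ℕ) (hk : 1 ≤ k) : gL p k i 0 = 0 := by
  induction i with
  | zero => exact gL_zero p k 0
  | succ i ih =>
    rw [gL_succ, ih, gw_zero, if_neg (by omega)]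

theorem gL_symm (p : ℕ → ℕ) (hp : ∀ i, p (p i) = i) (k : ℕ) (hk : 1 ≤ k) :
    ∀ s i j, i + j = s → gL p k i j = gL p k j i := by
  intro s
  induction s using Nat.strong_induction_on with
  | _ s ih =>
    intro i j hs
    cases i with
    | zero => rw [gL_zero, gL_zero' p k j hk]
    | succ i =>
      cases j with
      | zero => rw [gL_zero, gL_zero' p k _ hk]
      | succ j =>
        have h1 := ih (i + (j + 1)) (by omega) i (j + 1) rfl
        have h2 := ih (j + (i + 1)) (by omega) j (i + 1) rfl
        have h3 := ih (i + j) (by omega) i j rfl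
        rw [gL_succ, gL_succ, h1, h2, gL_succ, gL_succ, h3]
        have hx : p i = j ↔ p j = i := by
          constructor <;> intro h <;> rw [← h, hp]
        rw [gw_succ p i j, gw_succ p j i]
        by_cases h : gw p i j = gw p j i
        · simp only [h, if_true, hx]
        · rw [if_neg h, if_neg (Ne.symm h)]; omega

theorem gL_comm (p : ℕ → ℕ) (hp : ∀ i, p (p i) = i) (k : ℕ) (hk : 1 ≤ k) (i j : ℕ) :
    gL p k i j = gL p k j i := gL_symm p hp k hk _ i j rfl

theorem gL_succ' (p : ℕ → ℕ) (hp : ∀ i, p (p i) = i) (k : ℕ) (hk : 1 ≤ k) (i j : ℕ) :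
    gL p k i (j + 1) = gL p k i j + if gw p j i = k then 1 else 0 := by
  rw [gL_comm p hp k hk, gL_succ, gL_comm p hp k hk]

theorem gL_part (p : ℕ → ℕ) (hp : ∀ i, p (p i) = i) (k : ℕ) (hk : 1 ≤ k) :
    ∀ i j, gL p (k + 1) i j ≤ gL p k i j := by
  intro i
  induction i with
  | zero => intro j; simp [gL_zero]
  | succ i ihi =>
    intro j
    induction j with
    | zero => rw [gL_zero' _ _ _ (by omega)]; omega
    | succ j ihj =>
      have h1 := ihi j
      have h2 := ihi (j + 1)
      rw [gL_succ' p hp _ (by omega), gL_succ' p hp _ hk] at h2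
      rw [gL_succ, gL_succ] at ihj
      rw [gL_succ, gL_succ, gL_succ' p hp _ (by omega), gL_succ' p hp _ hk, gw_succ]
      generalize gw p i j = a at *
      generalize gw p j i = v at *
      generalize gL p (k + 1) i j = A at *
      generalize gL p k i j = B at *
      by_cases h : a = v
      · subst h
        simp only [if_true]
        split_ifs at * <;> omega
      · simp only [if_neg h]
        split_ifs at * <;> omega

theorem gw_ascent (p : ℕ → ℕ) (hp : ∀ i, p (p i) = i) (i : ℕ) (h : p i < p (i + 1)) :
    ∀ j, gw p (i + 1) j ≤ gw p i j := by
  intro j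
  induction j with
  | zero => simp [gw_zero]
  | succ j ih =>
    have h0 := gw_pos_iff p hp i j
    rw [gw_succ p (i + 1) j, gw_succ p i j, gw_succ p j i]
    have hx : p i = j ↔ p j = i := by
      constructor <;> intro h <;> rw [← h, hp]
    generalize gw p i j = a at *
    generalize gw p j i = v at *
    generalize gw p (i + 1) j = b at *
    split_ifs at * <;> omega

theorem gw_descent (p : ℕ → ℕ) (hp : ∀ i, p (p i) = i) (i : ℕ) (h : p (i + 1) < p i) :
    ∀ j, gw p i j = 0 ∨ gw p i j < gw p (i + 1) j := by
  intro j
  induction j with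
  | zero => simp [gw_zero]
  | succ j ih =>
    have h0 := gw_pos_iff p hp i j
    have h0' := gw_pos_iff p hp (i + 1) j
    rw [gw_succ p (i + 1) j, gw_succ p i j, gw_succ p j i]
    have hx : p i = j ↔ p j = i := by
      constructor <;> intro h <;> rw [← h, hp]
    generalize gw p i j = a at *
    generalize gw p j i = v at *
    generalize gw p (i + 1) j = b at *
    split_ifs at * <;> omega

theorem gw_descent_iff (p : ℕ → ℕ) (hp : ∀ i, p (p i) = i) (i N : ℕ) (h : p i < N) :
    gw p i N < gw p (i + 1) N ↔ p (i + 1) < p i := by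
  constructor
  · intro h1
    by_contra h2
    have h3 : p i ≠ p (i + 1) := by
      intro h3
      have := congrArg p h3
      rw [hp, hp] at this
      omega
    have := gw_ascent p hp i (by omega) N
    omega
  · intro h1
    have h2 := gw_pos_iff p hp i N
    rcases gw_descent p hp i h1 N with h3 | h3
    · omega
    · exact h3

/-- Existence of an increasing chain of `k` points in `[i] × [j]`. -/
def Ch (p : ℕ → ℕ) : ℕ → ℕ → ℕ → Prop
  | 0, _, _ => True
  | k + 1, i, j => ∃ s, s < i ∧ p s < j ∧ Ch p k s (p s)

theorem Ch_mono (p : ℕ → ℕ) (k i j i' j' : ℕ) (hi : i ≤ i') (hj : j ≤ j') (h : Ch p k i j) :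
    Ch p k i' j' := by
  cases k with
  | zero => trivial
  | succ k =>
    obtain ⟨s, h1, h2, h3⟩ := h
    exact ⟨s, by omega, by omega, h3⟩

theorem Ch_of_le (p : ℕ → ℕ) (hp : ∀ i, p (p i) = i) :
    ∀ i j k, k ≤ gL p 1 i j → Ch p k i j := by
  intro i
  induction i with
  | zero =>
    intro j k hk
    rw [gL_zero] at hk
    obtain rfl : k = 0 := by omega
    trivial
  | succ i ihi =>
    intro j
    induction j with
    | zero =>
      intro k hk
      rw [gL_zero' _ _ _ le_rfl] at hk
      obtain rfl : k = 0 := by omega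
      trivial
    | succ j ihj =>
      intro k hk
      cases k with
      | zero => trivial
      | succ k =>
      have hx : p i = j ↔ p j = i := by
        constructor <;> intro h <;> rw [← h, hp]
      by_cases hX : p i = j
      · have h0 := gw_pos_iff p hp j i
        rw [gL_succ, gL_succ' p hp _ le_rfl] at hk
        refine ⟨i, by omega, by omega, ?_⟩
        rw [hX]
        apply ihi
        split_ifs at hk <;> omega
      · by_cases hH : gw p i (j + 1) = 1
        · apply Ch_mono p (k + 1) (i + 1) j _ _ le_rfl (by omega)
          apply ihj
          rw [gL_succ, gL_succ' p hp _ le_rfl] at hk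
          rw [gL_succ]
          rw [gw_succ] at hk hH
          rw [if_neg hX] at hk hH
          generalize gw p i j = a at *
          generalize gw p j i = v at *
          split_ifs at * <;> omega
        · apply Ch_mono p (k + 1) i (j + 1) _ _ (by omega) le_rfl
          apply ihi
          rw [gL_succ, if_neg hH] at hk
          exact hk

theorem gL_mono (p : ℕ → ℕ) (hp : ∀ i, p (p i) = i) (i j i' j' : ℕ) (hi : i ≤ i')
    (hj : j ≤ j') : gL p 1 i j ≤ gL p 1 i' j' := by
  calc gL p 1 i j ≤ gL p 1 i' j := Nat.count_monotone _ hi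
    _ = gL p 1 j i' := gL_comm p hp _ le_rfl _ _
    _ ≤ gL p 1 j' i' := Nat.count_monotone _ hj
    _ = gL p 1 i' j' := gL_comm p hp _ le_rfl _ _

theorem le_of_Ch (p : ℕ → ℕ) (hp : ∀ i, p (p i) = i) :
    ∀ k i j, Ch p k i j → k ≤ gL p 1 i j := by
  intro k
  induction k with
  | zero => intros; omega
  | succ k ih =>
    rintro i j ⟨s, h1, h2, h3⟩
    have h4 := ih _ _ h3
    have h5 := gL_mono p hp (s + 1) (p s + 1) i j h1 h2
    have h0 := gw_pos_iff p hp s (p s)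
    have h0' := gw_pos_iff p hp (p s) s
    rw [hp] at h0'
    have h6 : gw p s (p s + 1) = 1 := by
      rw [gw_succ, h0.2 le_rfl, h0'.2 le_rfl]; simp
    rw [gL_succ, h6, gL_succ' p hp _ le_rfl] at h5
    simp at h5
    omega
/-- Backward growth: edge labels from the boundary word `w`, in reversed coordinates
for the distance of the second argument to the boundary. -/
def bw (w : ℕ → ℕ) (N : ℕ) (i j : ℕ) : ℕ :=
  if h : i < N ∧ j < N then
    (if bw w N i (j + 1) = bw w N j (i + 1) then bw w N i (j + 1) - 1 else bw w N i (j + 1))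
  else w i
termination_by (N - i) + (N - j)

theorem bw_top (w : ℕ → ℕ) (N i : ℕ) : bw w N i N = w i := by
  rw [bw, dif_neg (by omega)]

theorem bw_step (w : ℕ → ℕ) (N i j : ℕ) (hi : i < N) (hj : j < N) : bw w N i j =
    if bw w N i (j + 1) = bw w N j (i + 1) then bw w N i (j + 1) - 1 else bw w N i (j + 1) := by
  rw [bw, dif_pos ⟨hi, hj⟩]

theorem bw_le (w : ℕ → ℕ) (N i : ℕ) (hi : i < N) (d : ℕ) : ∀ j, j + d = N →
    bw w N i j ≤ w i := by
  induction d with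
  | zero =>
    intro j hj
    obtain rfl : j = N := by omega
    rw [bw_top]
  | succ d ih =>
    intro j hj
    have := ih (j + 1) (by omega)
    rw [bw_step w N i j hi (by omega)]
    split_ifs <;> omega

/-- Integer shapes of the backward growth. `d` is the distance to the top. -/
def bZ (w : ℕ → ℕ) (N k i : ℕ) : ℕ → ℤ
  | 0 => (Nat.count (fun s => w s = k) i : ℤ)
  | d + 1 => bZ w N k i d - if bw w N (N - (d + 1)) i = k then 1 else 0

theorem bZ_succ (w : ℕ → ℕ) (N k i : ℕ) (hk : 1 ≤ k) (hi : i < N) : ∀ d, d ≤ N →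
    bZ w N k (i + 1) d = bZ w N k i d + if bw w N i (N - d) = k then 1 else 0 := by
  intro d
  induction d with
  | zero =>
    intro _
    simp [bZ, Nat.count_succ, bw_top]
  | succ d ih =>
    intro hd
    have h1 := ih (by omega)
    simp only [bZ]
    rw [h1]
    have e : N - d = N - (d + 1) + 1 := by omega
    rw [e]
    generalize N - (d + 1) = j at *
    have hj : j < N := by omega
    rw [bw_step w N i j hi hj, bw_step w N j i hj hi]
    generalize bw w N i (j + 1) = a at *
    generalize bw w N j (i + 1) = v at *
    by_cases h : a = v
    · subst h; simp only [if_true]; ring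
    · simp only [if_neg h, if_neg (Ne.symm h)]; ring

theorem bZ_right (w : ℕ → ℕ) (N k : ℕ) : ∀ d, d ≤ N →
    bZ w N k N d = (Nat.count (fun s => w s = k) (N - d) : ℤ) := by
  intro d
  induction d with
  | zero => intro _; simp [bZ]
  | succ d ih =>
    intro hd
    simp only [bZ]
    rw [ih (by omega), show N - d = N - (d + 1) + 1 by omega, Nat.count_succ, bw_top]
    push_cast
    ring

theorem bZ_part (w : ℕ → ℕ) (N k : ℕ) (hk : 1 ≤ k)
    (hw : ∀ i, i ≤ N → Nat.count (fun s => w s = k + 1) i ≤ Nat.count (fun s => w s = k) i) :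
    ∀ d, d ≤ N → ∀ e, e ≤ N → bZ w N (k + 1) (N - e) d ≤ bZ w N k (N - e) d := by
  intro d
  induction d with
  | zero =>
    intro _ e _
    simp only [bZ]
    exact_mod_cast hw _ (by omega)
  | succ d ihd =>
    intro hd e
    induction e with
    | zero =>
      intro _
      rw [Nat.sub_zero, bZ_right _ _ _ _ hd, bZ_right _ _ _ _ hd]
      exact_mod_cast hw _ (by omega)
    | succ e ihe =>
      intro he
      have h1 := ihd (by omega) e (by omega)
      have h2 := ihd (by omega) (e + 1) (by omega)
      have h3 := ihe (by omega)
      rw [show N - e = N - (e + 1) + 1 by omega] at h1 h3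
      have hi : N - (e + 1) < N := by omega
      generalize N - (e + 1) = i at *
      rw [bZ_succ w N _ _ (by omega) hi _ (by omega), bZ_succ w N _ _ hk hi _ (by omega)] at h1
      simp only [bZ] at h3 ⊢
      rw [bZ_succ w N _ _ (by omega) hi _ (by omega), bZ_succ w N _ _ hk hi _ (by omega)] at h3
      rw [show N - d = N - (d + 1) + 1 by omega] at h1 h3
      have hj : N - (d + 1) < N := by omega
      generalize N - (d + 1) = j at *
      rw [bw_step w N j i hj hi]
      generalize bw w N i (j + 1) = a at *
      generalize bw w N j (i + 1) = v at *
      generalize bZ w N (k + 1) i d = A at *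
      generalize bZ w N k i d = B at *
      split_ifs at * <;> omega

theorem bZ_big (w : ℕ → ℕ) (N k : ℕ) (hw : ∀ i, i < N → w i < k) (i : ℕ) (hi : i ≤ N) :
    ∀ d, d ≤ N → bZ w N k i d = 0 := by
  intro d
  induction d with
  | zero =>
    intro _
    simp only [bZ]
    norm_cast
    rw [Nat.count_eq_card_filter_range, Finset.card_eq_zero, Finset.filter_eq_empty_iff]
    intro x hx
    have := hw x (by rw [Finset.mem_range] at hx; omega)
    omega
  | succ d ih =>
    intro hd
    simp only [bZ]
    rw [ih (by omega), if_neg]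
    · simp
    · have h1 := bw_le w N (N - (d + 1)) (by omega) (N - i) i (by omega)
      have h2 := hw (N - (d + 1)) (by omega)
      omega

theorem bZ_nonneg (w : ℕ → ℕ) (N : ℕ)
    (hw : ∀ k, 1 ≤ k → ∀ i, i ≤ N →
      Nat.count (fun s => w s = k + 1) i ≤ Nat.count (fun s => w s = k) i)
    (k i d : ℕ) (hk : 1 ≤ k) (hi : i ≤ N) (hd : d ≤ N) : 0 ≤ bZ w N k i d := by
  obtain ⟨K, hK⟩ : ∃ K, ∀ i, i < N → w i < K := by
    refine ⟨(Finset.range N).sup w + 1, fun i hi => ?_⟩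
    have := Finset.le_sup (f := w) (Finset.mem_range.2 hi)
    omega
  have key : ∀ t, bZ w N (k + t) i d ≤ bZ w N k i d := by
    intro t
    induction t with
    | zero => simp
    | succ t ih =>
      have := bZ_part w N (k + t) (by omega) (hw _ (by omega)) d hd (N - i) (by omega)
      rw [show N - (N - i) = i by omega] at this
      exact le_trans this ih
  have h := key K
  rwa [bZ_big w N (k + K) (fun i hi => lt_of_lt_of_le (hK i hi) (by omega)) i hi d hd] at h

theorem bw_bottom (w : ℕ → ℕ) (N : ℕ)
    (hw : ∀ k, 1 ≤ k → ∀ i, i ≤ N →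
      Nat.count (fun s => w s = k + 1) i ≤ Nat.count (fun s => w s = k) i)
    (i : ℕ) (hi : i < N) : bw w N i 0 = 0 := by
  by_contra h
  have hk : 1 ≤ bw w N i 0 := by omega
  set k := bw w N i 0 with hkdef
  have mono : ∀ d, d ≤ N → bZ w N k 0 d ≤ 0 := by
    intro d
    induction d with
    | zero => intro _; simp [bZ]
    | succ d ih =>
      intro hd
      have := ih (by omega)
      simp only [bZ]
      split_ifs <;> omega
  have h1 := mono (N - (i + 1)) (by omega)
  have h2 := bZ_nonneg w N hw k 0 (N - (i + 1) + 1) hk (by omega) (by omega)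
  simp only [bZ] at h2
  rw [show N - (N - (i + 1) + 1) = i by omega, if_pos hkdef.symm] at h2
  omega

/-- The involution recovered from the backward growth. -/
theorem exists_involution (w : ℕ → ℕ) (N : ℕ)
    (hw : ∀ k, 1 ≤ k → ∀ i, i ≤ N →
      Nat.count (fun s => w s = k + 1) i ≤ Nat.count (fun s => w s = k) i)
    (hpos : ∀ i, i < N → 1 ≤ w i) :
    ∃ p : ℕ → ℕ, (∀ i, p (p i) = i) ∧ (∀ i, i < N → p i < N) ∧ (∀ i, N ≤ i → p i = i) ∧
      ∀ i, i < N → gw p i N = w i := by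
  have ex : ∀ i, i < N → ∃ j, j < N ∧ bw w N i j = 0 ∧ bw w N i (j + 1) ≠ 0 := by
    intro i hi
    by_contra hcon
    push Not at hcon
    have : ∀ j, j ≤ N → bw w N i j = 0 := by
      intro j
      induction j with
      | zero => intro _; exact bw_bottom w N hw i hi
      | succ j ih => intro hj; exact hcon j (by omega) (ih (by omega))
    have h1 := this N le_rfl
    rw [bw_top] at h1
    have := hpos i hi
    omega
  have mono : ∀ i, i < N → ∀ j, j < N → bw w N i j ≤ bw w N i (j + 1) := by
    intro i hi j hj
    rw [bw_step w N i j hi hj]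
    split_ifs <;> omega
  have mono' : ∀ i, i < N → ∀ j' j, j ≤ j' → j' ≤ N → bw w N i j ≤ bw w N i j' := by
    intro i hi j'
    induction j' with
    | zero => intro j hj _; obtain rfl : j = 0 := by omega
              exact le_rfl
    | succ j' ih =>
      intro j hj hN
      rcases Nat.lt_or_ge j (j' + 1) with h | h
      · exact le_trans (ih j (by omega) (by omega)) (mono i hi j' (by omega))
      · obtain rfl : j = j' + 1 := by omega
        exact le_rfl
  choose! q hq using ex
  have uniq : ∀ i, i < N → ∀ j, j < N → bw w N i j = 0 → bw w N i (j + 1) ≠ 0 → q i = j := by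
    intro i hi j hj h1 h2
    obtain ⟨hq1, hq2, hq3⟩ := hq i hi
    rcases Nat.lt_trichotomy (q i) j with h | h | h
    · have := mono' i hi j (q i + 1) h (by omega); omega
    · exact h
    · have := mono' i hi (q i) (j + 1) h (by omega); omega
  have symm : ∀ i, i < N → ∀ j, j < N → bw w N i j = 0 → bw w N i (j + 1) ≠ 0 →
      bw w N j i = 0 ∧ bw w N j (i + 1) ≠ 0 := by
    intro i hi j hj h1 h2
    rw [bw_step w N i j hi hj] at h1
    rw [bw_step w N j i hj hi]
    split_ifs at h1 ⊢ <;> omega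
  have hqq : ∀ i, i < N → q (q i) = i := by
    intro i hi
    obtain ⟨hq1, hq2, hq3⟩ := hq i hi
    obtain ⟨h1, h2⟩ := symm i hi _ hq1 hq2 hq3
    exact uniq _ hq1 i hi h1 h2
  let p : ℕ → ℕ := fun i => if i < N then q i else i
  have hpN : ∀ i, i < N → p i = q i := fun i hi => if_pos hi
  have hpN' : ∀ i, N ≤ i → p i = i := fun i hi => if_neg (by omega)
  refine ⟨p, ?_, ?_, hpN', ?_⟩
  · intro i
    rcases Nat.lt_or_ge i N with h | h
    · rw [hpN i h, hpN _ (hq i h).1, hqq i h]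
    · rw [hpN' i h, hpN' i h]
  · intro i hi
    rw [hpN i hi]
    exact (hq i hi).1
  · have main : ∀ s i j, i + j = s → i < N → j ≤ N → gw p i j = bw w N i j := by
      intro s
      induction s using Nat.strong_induction_on with
      | _ s ih =>
        intro i j hs hi hj
        rcases j with _ | j
        · rw [gw_zero, bw_bottom w N hw i hi]
        · have h1 := ih (i + j) (by omega) i j rfl hi (by omega)
          have h2 := ih (j + i) (by omega) j i rfl (by omega) (by omega)
          rw [gw_succ, h1, h2, hpN i hi]
          have hu := uniq i hi j (by omega)
          have hq' := hq i hi
          by_cases hX : q i = j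
          · rw [hX] at hq'
            have hs := symm i hi j (by omega) hq'.2.1 hq'.2.2
            have e1 := bw_step w N i j hi (by omega)
            rw [if_pos (by omega), if_pos (by omega), if_pos hX]
            split_ifs at e1 <;> omega
          · have hnot : bw w N i j = 0 → bw w N i (j + 1) = 0 := by
              intro h; by_contra h'; exact hX (hu h h')
            have hnot' : bw w N j i = 0 → bw w N j (i + 1) = 0 := by
              intro h; by_contra h'
              have := symm j (by omega) i hi h h'
              exact hX (hu this.1 this.2)
            rw [if_neg hX]
            have e1 := bw_step w N i j hi (by omega)
            have e2 := bw_step w N j i (by omega) hi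
            generalize bw w N i (j + 1) = a at *
            generalize bw w N j (i + 1) = v at *
            generalize bw w N i j = a0 at *
            generalize bw w N j i = v0 at *
            by_cases hav : a = v
            · subst hav
              simp only [if_true] at e1 e2
              by_cases h0 : a0 = 0
              · have := hnot h0
                rw [if_pos (by omega), if_pos h0]; omega
              · rw [if_pos (by omega), if_neg h0]; omega
            · rw [if_neg hav] at e1
              rw [if_neg (Ne.symm hav)] at e2
              rw [if_neg (by omega), e1]
    intro i hi
    rw [main _ i N rfl hi le_rfl, bw_top]
/-- Shape rows as a function of the column heights. -/
def lam (c1 c2 c3 k : ℕ) : ℕ :=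
  if k = 0 then 0 else
    (if k ≤ c1 then 1 else 0) + (if k ≤ c2 then 1 else 0) + (if k ≤ c3 then 1 else 0)

/-- Lattice condition for a word appended to the shape `f`. -/
def LatL : (ℕ → ℕ) → List ℕ → Prop
  | _, [] => True
  | f, a :: t => (1 ≤ a ∧ (a = 1 → f 1 < 3) ∧ (1 < a → f a < f (a - 1))) ∧
      LatL (fun k => f k + if a = k then 1 else 0) t

/-- The up/down comparison. -/
def cmpB (b : Bool) (x a : ℕ) : Prop := if b then x < a else a ≤ x

instance (b : Bool) (x a : ℕ) : Decidable (cmpB b x a) := by unfold cmpB; infer_instance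

/-- Alternation condition. -/
def AltL : Bool → ℕ → List ℕ → Prop
  | _, _, [] => True
  | b, x, a :: t => cmpB b x a ∧ AltL (!b) a t

/-- Enumeration of words. -/
def EE : ℕ → Bool → ℕ → ℕ → ℕ → ℕ → Finset (List ℕ)
  | 0, _, _, _, _, _ => {[]}
  | m + 1, b, x, c1, c2, c3 =>
    (if cmpB b x (c1 + 1) then
      (EE m (!b) (c1 + 1) (c1 + 1) c2 c3).image (List.cons (c1 + 1)) else ∅) ∪
    ((if c2 < c1 ∧ cmpB b x (c2 + 1) then
      (EE m (!b) (c2 + 1) c1 (c2 + 1) c3).image (List.cons (c2 + 1)) else ∅) ∪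
    (if c3 < c2 ∧ cmpB b x (c3 + 1) then
      (EE m (!b) (c3 + 1) c1 c2 (c3 + 1)).image (List.cons (c3 + 1)) else ∅))

theorem mem_ite_image (P : Prop) [Decidable P] (S : Finset (List ℕ)) (r a : ℕ) (t : List ℕ) :
    (a :: t ∈ (if P then S.image (List.cons r) else ∅)) ↔ (a = r ∧ P ∧ t ∈ S) := by
  split_ifs with h
  · simp only [Finset.mem_image, List.cons.injEq]
    constructor
    · rintro ⟨x, hx, rfl, rfl⟩; exact ⟨rfl, h, hx⟩
    · rintro ⟨rfl, -, hx⟩; exact ⟨t, hx, rfl, rfl⟩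
  · simp [h]

theorem nil_ite_image (P : Prop) [Decidable P] (S : Finset (List ℕ)) (r : ℕ) :
    ¬ ([] ∈ (if P then S.image (List.cons r) else ∅)) := by
  split_ifs <;> simp

theorem card_ite_image (P : Prop) [Decidable P] (S : Finset (List ℕ)) (r : ℕ) :
    (if P then S.image (List.cons r) else ∅).card = if P then S.card else 0 := by
  split_ifs
  · exact Finset.card_image_of_injective _ (List.cons_injective)
  · rfl

theorem lam_1 (c1 c2 c3 : ℕ) : (fun k => lam c1 c2 c3 k + if c1 + 1 = k then 1 else 0)
    = lam (c1 + 1) c2 c3 := by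
  funext k; unfold lam; split_ifs <;> omega

theorem lam_2 (c1 c2 c3 : ℕ) : (fun k => lam c1 c2 c3 k + if c2 + 1 = k then 1 else 0)
    = lam c1 (c2 + 1) c3 := by
  funext k; unfold lam; split_ifs <;> omega

theorem lam_3 (c1 c2 c3 : ℕ) : (fun k => lam c1 c2 c3 k + if c3 + 1 = k then 1 else 0)
    = lam c1 c2 (c3 + 1) := by
  funext k; unfold lam; split_ifs <;> omega

theorem lam_valid (c1 c2 c3 a : ℕ) (h1 : c2 ≤ c1) (h2 : c3 ≤ c2) :
    (1 ≤ a ∧ (a = 1 → lam c1 c2 c3 1 < 3) ∧ (1 < a → lam c1 c2 c3 a < lam c1 c2 c3 (a - 1))) ↔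
    (a = c1 + 1 ∨ (a = c2 + 1 ∧ c2 < c1) ∨ (a = c3 + 1 ∧ c3 < c2)) := by
  unfold lam
  constructor
  · rintro ⟨ha, hb, hc⟩
    rcases Nat.lt_or_ge 1 a with h | h
    · have := hc h
      split_ifs at this <;> omega
    · have := hb (by omega)
      simp only [one_ne_zero, if_false] at this
      split_ifs at this <;> omega
  · intro h
    refine ⟨by omega, fun h' => ?_, fun h' => ?_⟩
    · split_ifs <;> omega
    · split_ifs <;> omega

theorem mem_EE : ∀ (m : ℕ) (b : Bool) (x c1 c2 c3 : ℕ) (_ : c2 ≤ c1) (_ : c3 ≤ c2) (l : List ℕ),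
    l ∈ EE m b x c1 c2 c3 ↔ (l.length = m ∧ LatL (lam c1 c2 c3) l ∧ AltL b x l) := by
  intro m
  induction m with
  | zero =>
    intro b x c1 c2 c3 _ _ l
    cases l <;> simp [EE, LatL, AltL]
  | succ m ih =>
    intro b x c1 c2 c3 h1 h2 l
    cases l with
    | nil =>
      rw [EE]
      simp only [Finset.mem_union, nil_ite_image]
      simp
    | cons a t =>
      rw [EE]
      simp only [Finset.mem_union, mem_ite_image]
      rw [ih _ _ _ _ _ (by omega) (by omega)]
      simp only [LatL, AltL, lam_valid c1 c2 c3 a h1 h2, List.length_cons, Nat.add_right_cancel_iff]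
      constructor
      · rintro (⟨rfl, h, h', hz2, hz3⟩ | ⟨rfl, h, h'⟩ | ⟨rfl, h, h'⟩)
        · rw [lam_1]; exact ⟨h', ⟨Or.inl rfl, hz2⟩, h, hz3⟩
        · rw [ih _ _ _ _ _ (by omega) (by omega)] at h'
          rw [lam_2]; exact ⟨h'.1, ⟨Or.inr (Or.inl ⟨rfl, h.1⟩), h'.2.1⟩, h.2, h'.2.2⟩
        · rw [ih _ _ _ _ _ (by omega) (by omega)] at h'
          rw [lam_3]; exact ⟨h'.1, ⟨Or.inr (Or.inr ⟨rfl, h.1⟩), h'.2.1⟩, h.2, h'.2.2⟩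
      · rintro ⟨hl, ⟨(rfl | ⟨rfl, h⟩ | ⟨rfl, h⟩), h'⟩, hz2, hz3⟩
        · rw [lam_1] at h'
          exact Or.inl ⟨rfl, hz2, hl, h', hz3⟩
        · rw [lam_2] at h'
          refine Or.inr (Or.inl ⟨rfl, ⟨h, hz2⟩, ?_⟩)
          rw [ih _ _ _ _ _ (by omega) (by omega)]
          exact ⟨hl, h', hz3⟩
        · rw [lam_3] at h'
          refine Or.inr (Or.inr ⟨rfl, ⟨h, hz2⟩, ?_⟩)
          rw [ih _ _ _ _ _ (by omega) (by omega)]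
          exact ⟨hl, h', hz3⟩

theorem card_EE_succ (m : ℕ) (b : Bool) (x c1 c2 c3 : ℕ) (h1 : c2 ≤ c1) (h2 : c3 ≤ c2) :
    (EE (m + 1) b x c1 c2 c3).card =
      (if cmpB b x (c1 + 1) then (EE m (!b) (c1 + 1) (c1 + 1) c2 c3).card else 0) +
      ((if c2 < c1 ∧ cmpB b x (c2 + 1) then (EE m (!b) (c2 + 1) c1 (c2 + 1) c3).card else 0) +
      (if c3 < c2 ∧ cmpB b x (c3 + 1) then (EE m (!b) (c3 + 1) c1 c2 (c3 + 1)).card else 0)) := by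
  rw [EE, Finset.card_union_of_disjoint, Finset.card_union_of_disjoint]
  · simp only [card_ite_image]
  · rw [Finset.disjoint_left]
    intro l
    cases l with
    | nil => simp only [nil_ite_image, not_false_eq_true, implies_true]
    | cons a t => simp only [mem_ite_image]; omega
  · rw [Finset.disjoint_left]
    intro l
    cases l with
    | nil => simp only [nil_ite_image]; simp
    | cons a t => simp only [mem_ite_image, Finset.mem_union]; omega

/-- Even-length counts, last letter in column one. -/
def cF (n c1 c2 c3 : ℕ) : ℕ := (EE (2 * n) false c1 c1 c2 c3).card
/-- Even-length counts, last letter in column two. -/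
def cG (n c1 c2 c3 : ℕ) : ℕ := (EE (2 * n) false c2 c1 c2 c3).card
/-- Even-length counts, last letter in column three. -/
def cK (n c1 c2 c3 : ℕ) : ℕ := (EE (2 * n) false c3 c1 c2 c3).card

theorem cF_zero (c1 c2 c3 : ℕ) : cF 0 c1 c2 c3 = 1 := by simp [cF, EE]
theorem cG_zero (c1 c2 c3 : ℕ) : cG 0 c1 c2 c3 = 1 := by simp [cG, EE]
theorem cK_zero (c1 c2 c3 : ℕ) : cK 0 c1 c2 c3 = 1 := by simp [cK, EE]

theorem cK_succ (n c1 c2 c3 : ℕ) (h1 : c2 ≤ c1) (h2 : c3 ≤ c2) : cK (n + 1) c1 c2 c3 = 0 := by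
  unfold cK
  rw [show 2 * (n + 1) = (2 * n + 1) + 1 by ring, card_EE_succ _ _ _ _ _ _ h1 h2]
  rw [if_neg, if_neg, if_neg] <;> simp [cmpB] <;> omega

/-- Completion after a first letter in column three. -/
theorem card_three (n c1 c2 c3 : ℕ) (h1 : c2 ≤ c1) (h2 : c3 < c2) :
    (EE (2 * n + 1) true (c3 + 1) c1 c2 (c3 + 1)).card =
      cF n (c1 + 1) c2 (c3 + 1) + (if c2 < c1 then cG n c1 (c2 + 1) (c3 + 1) else 0) +
        (if c3 + 1 < c2 then cK n c1 c2 (c3 + 2) else 0) := by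
  rw [card_EE_succ _ _ _ _ _ _ h1 h2]
  simp only [cmpB, cF, cG, cK, if_true, Bool.not_true]
  rw [if_pos (by omega)]
  have e1 : (c2 < c1 ∧ c3 + 1 < c2 + 1) ↔ c2 < c1 := by omega
  have e2 : (c3 + 1 < c2 ∧ c3 + 1 < c3 + 1 + 1) ↔ c3 + 1 < c2 := by omega
  simp only [e1, e2]
  exact (add_assoc _ _ _).symm

theorem card_two (n c1 c2 c3 : ℕ) (h1 : c2 < c1) (h2 : c3 ≤ c2) :
    (EE (2 * n + 1) true (c2 + 1) c1 (c2 + 1) c3).card =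
      cF n (c1 + 1) (c2 + 1) c3 + (if c2 + 1 < c1 then cG n c1 (c2 + 2) c3 else 0) := by
  rw [card_EE_succ _ _ _ _ _ _ (by omega) (by omega)]
  simp only [cmpB, cF, cG, if_true, Bool.not_true]
  rw [if_pos (by omega), if_neg (c := c3 < c2 + 1 ∧ c2 + 1 < c3 + 1) (by omega)]
  have e1 : (c2 + 1 < c1 ∧ c2 + 1 < c2 + 1 + 1) ↔ c2 + 1 < c1 := by omega
  simp only [e1]
  ring_nf

theorem cG_succ (n c1 c2 c3 : ℕ) (h1 : c2 ≤ c1) (h2 : c3 ≤ c2) : cG (n + 1) c1 c2 c3 =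
    if c3 < c2 then cF n (c1 + 1) c2 (c3 + 1) + (if c2 < c1 then cG n c1 (c2 + 1) (c3 + 1) else 0) +
        (if c3 + 1 < c2 then cK n c1 c2 (c3 + 2) else 0) else 0 := by
  rw [cG, show 2 * (n + 1) = (2 * n + 1) + 1 by ring, card_EE_succ _ _ _ _ _ _ h1 h2]
  simp only [cmpB, Bool.false_eq_true, if_false, Bool.not_false]
  rw [if_neg (by omega), if_neg (by omega)]
  by_cases h : c3 < c2
  · rw [if_pos (by omega), if_pos h, card_three n c1 c2 c3 h1 h]; ring
  · rw [if_neg (by omega), if_neg h]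

theorem cF_succ (n c1 c2 c3 : ℕ) (h1 : c2 ≤ c1) (h2 : c3 ≤ c2) : cF (n + 1) c1 c2 c3 =
    (if c2 < c1 then
      cF n (c1 + 1) (c2 + 1) c3 + (if c2 + 1 < c1 then cG n c1 (c2 + 2) c3 else 0) else 0) +
    cG (n + 1) c1 c2 c3 := by
  rw [cG_succ n c1 c2 c3 h1 h2]
  rw [cF, show 2 * (n + 1) = (2 * n + 1) + 1 by ring, card_EE_succ _ _ _ _ _ _ h1 h2]
  simp only [cmpB, Bool.false_eq_true, if_false, Bool.not_false]
  rw [if_neg (by omega)]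
  have e1 : (c2 < c1 ∧ c2 + 1 ≤ c1) ↔ c2 < c1 := by omega
  have e2 : (c3 < c2 ∧ c3 + 1 ≤ c1) ↔ c3 < c2 := by omega
  simp only [e1, e2]
  rw [zero_add]
  congr 1
  · split_ifs with h h'
    · rw [card_two n c1 c2 c3 h h2, if_pos h']
    · rw [card_two n c1 c2 c3 h h2, if_neg h']
    · rfl
  · by_cases h : c3 < c2
    · rw [if_pos h, if_pos h, card_three n c1 c2 c3 h1 h]
    · rw [if_neg h, if_neg h]

theorem card_start (n : ℕ) : (EE (2 * (n + 1)) false 1 0 0 0).card = cF n 2 0 0 := by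
  rw [show 2 * (n + 1) = (2 * n + 1) + 1 by ring, card_EE_succ _ _ _ _ _ _ le_rfl le_rfl,
    card_EE_succ _ _ _ _ _ _ (by omega) (by omega)]
  simp [cmpB, cF]

/-- Generating function of a sequence of integers. -/
noncomputable def mS (M : ℕ → ℕ) : PowerSeries ℤ := PowerSeries.mk (fun n => (M n : ℤ))

theorem mS_eq (M : ℕ → ℕ) (hM0 : M 0 = 1)
    (hMrec : ∀ n, M (n + 1) = M n + ∑ k ∈ Finset.range n, M k * M (n - 1 - k)) :
    mS M = 1 + PowerSeries.X * mS M + PowerSeries.X * (PowerSeries.X * (mS M * mS M)) := by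
  ext n
  rcases n with _ | _ | n
  · simp [mS, hM0]
  · simp [mS, PowerSeries.coeff_succ_X_mul, hMrec, hM0, PowerSeries.coeff_one]
  · rw [map_add, map_add, PowerSeries.coeff_succ_X_mul, PowerSeries.coeff_succ_X_mul,
      PowerSeries.coeff_succ_X_mul, PowerSeries.coeff_mul]
    simp only [mS, PowerSeries.coeff_mk, PowerSeries.coeff_one]
    rw [hMrec (n + 1), Finset.Nat.sum_antidiagonal_eq_sum_range_succ_mk]
    push_cast
    simp

/-- Number of Motzkin paths from height `h` to `0` with `m` steps. -/
noncomputable def dM (M : ℕ → ℕ) (m h : ℕ) : ℤ :=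
  PowerSeries.coeff m (PowerSeries.X ^ h * mS M ^ (h + 1))

section
variable (M : ℕ → ℕ) (hM0 : M 0 = 1)
    (hMrec : ∀ n, M (n + 1) = M n + ∑ k ∈ Finset.range n, M k * M (n - 1 - k))

theorem dM_self (m : ℕ) : dM M m 0 = M m := by
  simp [dM, mS]

theorem dM_zero_left (h : ℕ) : dM M 0 h = if h = 0 then (M 0 : ℤ) else 0 := by
  unfold dM mS
  split_ifs with hh
  · subst hh; simp
  · simp [hh]

theorem dM_succ_zero (hM0 : M 0 = 1)
    (hMrec : ∀ n, M (n + 1) = M n + ∑ k ∈ Finset.range n, M k * M (n - 1 - k)) (m : ℕ) :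
    dM M (m + 1) 0 = dM M m 0 + dM M m 1 := by
  unfold dM
  have e : (PowerSeries.X ^ 0 * mS M ^ (0 + 1) : PowerSeries ℤ) = 1 + PowerSeries.X *
      ((PowerSeries.X ^ 0 * mS M ^ (0 + 1)) + (PowerSeries.X ^ 1 * mS M ^ (1 + 1))) := by
    linear_combination mS_eq M hM0 hMrec
  have e' := congrArg (PowerSeries.coeff (m + 1)) e
  rw [map_add, PowerSeries.coeff_succ_X_mul, map_add, PowerSeries.coeff_one, if_neg (by omega)]
    at e'
  exact e'.trans (zero_add _)

theorem dM_succ_succ (hM0 : M 0 = 1)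
    (hMrec : ∀ n, M (n + 1) = M n + ∑ k ∈ Finset.range n, M k * M (n - 1 - k)) (m h : ℕ) :
    dM M (m + 1) (h + 1) = dM M m h + dM M m (h + 1) + dM M m (h + 2) := by
  unfold dM
  have e : (PowerSeries.X ^ (h + 1) * mS M ^ (h + 1 + 1) : PowerSeries ℤ) = PowerSeries.X *
      ((PowerSeries.X ^ h * mS M ^ (h + 1)) + (PowerSeries.X ^ (h + 1) * mS M ^ (h + 1 + 1)) +
        (PowerSeries.X ^ (h + 2) * mS M ^ (h + 2 + 1))) := by
    linear_combination (PowerSeries.X ^ (h + 1) * mS M ^ (h + 1)) * mS_eq M hM0 hMrec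
  have e' := congrArg (PowerSeries.coeff (m + 1)) e
  rwa [PowerSeries.coeff_succ_X_mul, map_add, map_add] at e'

/-- Walk numbers in the Weyl chamber. -/
noncomputable def wM (m a b : ℕ) : ℤ :=
  ∑ i ∈ Finset.range a, ∑ j ∈ Finset.range b, dM M m (i + j)

theorem wM_rec (hM0 : M 0 = 1)
    (hMrec : ∀ n, M (n + 1) = M n + ∑ k ∈ Finset.range n, M k * M (n - 1 - k)) (m a b : ℕ) :
    wM M (m + 1) (a + 1) (b + 1) = wM M m (a + 1) (b + 2) + wM M m (a + 2) b + wM M m a (b + 1) := by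
  have row : ∀ b i, ∑ j ∈ Finset.range b, dM M (m + 1) (i + 1 + j) =
      ∑ j ∈ Finset.range b, dM M m (i + j) + ∑ j ∈ Finset.range b, dM M m (i + 1 + j) +
      ∑ j ∈ Finset.range b, dM M m (i + 2 + j) := by
    intro b i
    rw [← Finset.sum_add_distrib, ← Finset.sum_add_distrib]
    refine Finset.sum_congr rfl fun j _ => ?_
    rw [show i + 1 + j = i + j + 1 by ring, dM_succ_succ M hM0 hMrec,
      show i + 2 + j = i + j + 2 by ring]
  have row0 : ∀ b, ∑ j ∈ Finset.range (b + 1), dM M (m + 1) j =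
      ∑ j ∈ Finset.range b, dM M m j + ∑ j ∈ Finset.range (b + 1), dM M m j +
        ∑ j ∈ Finset.range (b + 2), dM M m j - dM M m 0 := by
    intro b
    induction b with
    | zero => simp [Finset.sum_range_succ, dM_succ_zero M hM0 hMrec]
    | succ b ih =>
      rw [Finset.sum_range_succ, ih, dM_succ_succ M hM0 hMrec, Finset.sum_range_succ _ b,
        Finset.sum_range_succ _ (b + 1), Finset.sum_range_succ _ (b + 2),
        Finset.sum_range_succ _ (b + 1), Finset.sum_range_succ _ b]
      ring
  have sh : ∀ b i, ∑ j ∈ Finset.range b, dM M m (i + 1 + j) =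
      ∑ j ∈ Finset.range b, dM M m (i + j) + dM M m (i + b) - dM M m i := by
    intro b i
    induction b with
    | zero => simp
    | succ b ih =>
      rw [Finset.sum_range_succ, ih, Finset.sum_range_succ, show i + 1 + b = i + (b + 1) by ring]
      ring
  unfold wM
  induction a with
  | zero =>
    have e := sh b 0
    have h3 := Finset.sum_range_succ (fun j => dM M m j) b
    simp only [zero_add, Finset.sum_range_succ _ 1, Finset.sum_range_one, Finset.sum_range_zero]
      at e ⊢
    rw [row0]
    linarith
  | succ a ih =>
    have t4 := Finset.sum_range_succ
      (fun i => ∑ j ∈ Finset.range (b + 1), dM M (m + 1) (i + j)) (a + 1)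
    have t5 := Finset.sum_range_succ (fun i => ∑ j ∈ Finset.range (b + 2), dM M m (i + j)) (a + 1)
    have t6 := Finset.sum_range_succ (fun i => ∑ j ∈ Finset.range b, dM M m (i + j)) (a + 2)
    have t7 := Finset.sum_range_succ (fun i => ∑ j ∈ Finset.range (b + 1), dM M m (i + j)) a
    have t8 := row (b + 1) a
    have t2 := Finset.sum_range_succ (fun j => dM M m (a + 1 + j)) (b + 1)
    have t3 := Finset.sum_range_succ (fun j => dM M m (a + 2 + j)) b
    simp only [show a + 1 + 1 = a + 2 by ring, show a + 1 + 2 = a + 2 + 1 by ring,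
      show b + 1 + 1 = b + 2 by ring, show a + 2 + b = a + 1 + (b + 1) by ring] at *
    linarith

theorem wM_zero_left (m b : ℕ) : wM M m 0 b = 0 := by simp [wM]

theorem wM_zero_right (m a : ℕ) : wM M m a 0 = 0 := by simp [wM]

theorem wM_zero (hM0 : M 0 = 1) (a b : ℕ) : wM M 0 a b = if a = 0 ∨ b = 0 then 0 else 1 := by
  rcases a with _ | a
  · simp [wM]
  rcases b with _ | b
  · simp [wM]
  unfold wM
  rw [Finset.sum_eq_single 0, Finset.sum_eq_single 0]
  · simp [dM_zero_left, hM0]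
  · intro j _ hj; simp [dM_zero_left, hj]
  · simp
  · intro i _ hi
    apply Finset.sum_eq_zero
    intro j _
    simp [dM_zero_left, hi]
  · simp

theorem wM_one (hM0 : M 0 = 1)
    (hMrec : ∀ n, M (n + 1) = M n + ∑ k ∈ Finset.range n, M k * M (n - 1 - k)) (a b : ℕ) :
    wM M 1 a b = if a = 0 ∨ b = 0 then 0 else
      1 + (if b = 1 then 0 else 1) + (if a = 1 then 0 else 1) := by
  rcases a with _ | a
  · simp [wM]
  rcases b with _ | b
  · simp [wM]
  rw [wM_rec M hM0 hMrec, wM_zero M hM0, wM_zero M hM0, wM_zero M hM0]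
  simp

theorem wM_two (m : ℕ) (hM0 : M 0 = 1)
    (hMrec : ∀ n, M (n + 1) = M n + ∑ k ∈ Finset.range n, M k * M (n - 1 - k)) :
    wM M m 2 2 = M (m + 2) - M m := by
  have h1 := dM_succ_zero M hM0 hMrec (m + 1)
  have h2 := dM_succ_zero M hM0 hMrec m
  have h3 := dM_succ_succ M hM0 hMrec m 0
  simp only [dM_self] at *
  simp [wM, Finset.sum_range_succ, dM_self]
  simp at h3
  linarith [dM_self M m]

/-- Difference of walk numbers. -/
noncomputable def uM (m a b : ℕ) : ℤ := wM M (m + 2) a b - wM M m a b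

theorem uM_zero_left (m b : ℕ) : uM M m 0 b = 0 := by simp [uM, wM_zero_left]

theorem uM_zero_right (m a : ℕ) : uM M m a 0 = 0 := by simp [uM, wM_zero_right]

theorem uM_rec (hM0 : M 0 = 1)
    (hMrec : ∀ n, M (n + 1) = M n + ∑ k ∈ Finset.range n, M k * M (n - 1 - k)) (m a b : ℕ) :
    uM M (m + 1) (a + 1) (b + 1) = uM M m (a + 1) (b + 2) + uM M m (a + 2) b + uM M m a (b + 1) := by
  unfold uM
  rw [show m + 1 + 2 = (m + 2) + 1 by ring, wM_rec M hM0 hMrec (m + 2), wM_rec M hM0 hMrec m]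
  ring
end

theorem cG_one (x y c : ℕ) : cG 1 (c + y + x) (c + y) c =
    if y = 0 then 0 else 1 + (if x = 0 then 0 else 1) + (if y = 1 then 0 else 1) := by
  rw [cG_succ 0 _ _ _ (by omega) (by omega)]
  simp only [cF_zero, cG_zero, cK_zero]
  split_ifs <;> omega

theorem cF_one (x y c : ℕ) : cF 1 (c + y + x) (c + y) c =
    (if x = 0 then 0 else 1 + (if x = 1 then 0 else 1)) +
    if y = 0 then 0 else 1 + (if x = 0 then 0 else 1) + (if y = 1 then 0 else 1) := by
  rw [cF_succ 0 _ _ _ (by omega) (by omega), cG_one]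
  simp only [cF_zero, cG_zero]
  congr 1
  split_ifs <;> omega

theorem cG_rec_zero (n x c : ℕ) : cG (n + 1) (c + 0 + x) (c + 0) c = 0 := by
  rw [cG_succ _ _ _ _ (by omega) (by omega), if_neg (by omega)]

theorem cG_rec (n x y c : ℕ) : cG (n + 2) (c + (y + 1) + x) (c + (y + 1)) c =
    cF (n + 1) ((c + 1) + y + (x + 1)) ((c + 1) + y) (c + 1) +
      if 0 < x then cG (n + 1) ((c + 1) + (y + 1) + (x - 1)) ((c + 1) + (y + 1)) (c + 1) else 0 := by
  rw [cG_succ _ _ _ _ (by omega) (by omega), if_pos (by omega)]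
  have hK : (if c + 1 < c + (y + 1) then cK (n + 1) (c + (y + 1) + x) (c + (y + 1)) (c + 2) else 0)
      = 0 := by
    split_ifs with h
    · exact cK_succ _ _ _ _ (by omega) (by omega)
    · rfl
  rw [hK, add_zero]
  congr 1
  · congr 1 <;> omega
  · by_cases h : 0 < x
    · rw [if_pos (by omega), if_pos h]; congr 1 <;> omega
    · rw [if_neg (by omega), if_neg h]

theorem cF_rec (n x y c : ℕ) : cF (n + 2) (c + y + x) (c + y) c =
    (if 0 < x then cF (n + 1) (c + (y + 1) + x) (c + (y + 1)) c +
      (if 1 < x then cG (n + 1) (c + (y + 2) + (x - 2)) (c + (y + 2)) c else 0) else 0) +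
    cG (n + 2) (c + y + x) (c + y) c := by
  rw [cF_succ _ _ _ _ (by omega) (by omega)]
  congr 1
  by_cases h : 0 < x
  · rw [if_pos (by omega), if_pos h]
    congr 1
    · congr 1; omega
    · by_cases h : 1 < x
      · rw [if_pos (by omega), if_pos h]; congr 1; omega
      · rw [if_neg (by omega), if_neg h]
  · rw [if_neg (by omega), if_neg h]

theorem cFG_closed (M : ℕ → ℕ) (hM0 : M 0 = 1)
    (hMrec : ∀ n, M (n + 1) = M n + ∑ k ∈ Finset.range n, M k * M (n - 1 - k)) (n : ℕ) :
    ∀ x y c, (cG (n + 2) (c + y + x) (c + y) c : ℤ) = uM M n (x + 1) y ∧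
      (cF (n + 2) (c + y + x) (c + y) c : ℤ) = uM M n (x + 1) y + uM M n x (y + 2) := by
  induction n with
  | zero =>
    intro x y c
    have hG : (cG (0 + 2) (c + y + x) (c + y) c : ℤ) = uM M 0 (x + 1) y := by
      rcases y with _ | y
      · rw [cG_rec_zero, uM_zero_right]; rfl
      · rw [cG_rec, zero_add, cF_one, cG_one,
          uM, zero_add, wM_rec M hM0 hMrec, wM_one M hM0 hMrec, wM_one M hM0 hMrec,
          wM_one M hM0 hMrec, wM_zero M hM0]
        rcases x with _ | _ | x <;> rcases y with _ | _ | y <;> simp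
    refine ⟨hG, ?_⟩
    rw [cF_rec]
    push_cast [hG]
    rw [add_comm]
    congr 1
    rw [cF_one, cG_one]
    rcases x with _ | x
    · rw [uM_zero_left]; simp
    · rw [uM, zero_add, wM_rec M hM0 hMrec, wM_one M hM0 hMrec, wM_one M hM0 hMrec,
          wM_one M hM0 hMrec, wM_zero M hM0]
      rcases x with _ | _ | x <;> rcases y with _ | _ | y <;> simp
  | succ n ih =>
    intro x y c
    have hG : (cG (n + 1 + 2) (c + y + x) (c + y) c : ℤ) = uM M (n + 1) (x + 1) y := by
      rcases y with _ | y
      · rw [cG_rec_zero, uM_zero_right]; rfl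
      · rw [cG_rec, uM_rec M hM0 hMrec]
        have h1 := (ih (x + 1) y (c + 1)).2
        rw [Nat.cast_add, show n + 1 + 1 = n + 2 by ring, h1]
        rcases x with _ | x
        · rw [uM_zero_left]; simp; ring
        · have h2 := (ih x (y + 1) (c + 1)).1
          rw [if_pos (by omega), show x + 1 - 1 = x by omega, h2]
          ring_nf
    refine ⟨hG, ?_⟩
    rw [cF_rec, Nat.cast_add, hG, add_comm]
    congr 1
    rcases x with _ | x
    · rw [uM_zero_left]; simp
    · rw [if_pos (by omega), uM_rec M hM0 hMrec, Nat.cast_add, show n + 1 + 1 = n + 2 by ring,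
        (ih (x + 1) (y + 1) c).2]
      rcases x with _ | x
      · rw [uM_zero_left]; simp; ring
      · rw [if_pos (by omega), show x + 1 + 1 - 2 = x by omega, (ih x (y + 2) c).1]
        ring_nf

theorem cF_answer (M : ℕ → ℕ) (hM0 : M 0 = 1)
    (hMrec : ∀ n, M (n + 1) = M n + ∑ k ∈ Finset.range n, M k * M (n - 1 - k)) (n : ℕ)
    (hn : 2 ≤ n) :
    ((EE (2 * n) false 1 0 0 0).card : ℤ) = (M (n + 1) : ℤ) - 2 * (M (n - 1) : ℤ) +
      (if 3 ≤ n then (M (n - 3) : ℤ) else 0) := by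
  obtain ⟨m, rfl⟩ : ∃ m, n = m + 2 := ⟨n - 2, by omega⟩
  rw [card_start (m + 1)]
  rcases m with _ | m
  · have h := cF_one 2 0 0
    simp only [zero_add] at h
    rw [zero_add, h]
    have h1 := hMrec 0
    have h2 := hMrec 1
    have h3 := hMrec 2
    simp [Finset.sum_range_succ, hM0] at h1 h2 h3
    simp [h1, h2, h3, hM0]
  · have h := (cFG_closed M hM0 hMrec m 2 0 0).2
    simp only [zero_add, uM_zero_right] at h
    rw [show m + 1 + 1 = m + 2 by ring, h, if_pos (by omega), uM, wM_two M _ hM0 hMrec,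
      wM_two M _ hM0 hMrec, show m + 1 + 2 + 1 = m + 2 + 2 by ring,
      show m + 1 + 2 - 1 = m + 2 by omega, show m + 1 + 2 - 3 = m by omega]
    ring
/-- Local lattice condition at position `i`. -/
def LocL (w : ℕ → ℕ) (i : ℕ) : Prop :=
  1 ≤ w i ∧ (w i = 1 → Nat.count (fun t => w t = 1) i < 3) ∧
    (1 < w i → Nat.count (fun t => w t = w i) i < Nat.count (fun t => w t = w i - 1) i)

theorem LatL_iff (w : ℕ → ℕ) (m : ℕ) : ∀ s,
    (LatL (fun k => Nat.count (fun t => w t = k) s) ((List.range' s m).map w) ↔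
      ∀ i, s ≤ i → i < s + m → LocL w i) := by
  induction m with
  | zero => intro s; simp [LatL]; intro i h1 h2; omega
  | succ m ih =>
    intro s
    have h := ih (s + 1)
    simp only [Nat.count_succ] at h
    rw [List.range'_succ, List.map_cons, LatL, h]
    constructor
    · rintro ⟨h1, h2⟩ i hi hi'
      rcases Nat.eq_or_lt_of_le hi with rfl | hlt
      · exact h1
      · exact h2 i hlt (by omega)
    · intro h1
      exact ⟨h1 s le_rfl (by omega), fun i hi hi' => h1 i (by omega) (by omega)⟩

theorem LatL_iff_zero (w : ℕ → ℕ) (m : ℕ) :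
    LatL (lam 0 0 0) ((List.range' 0 m).map w) ↔ ∀ i, i < m → LocL w i := by
  have h := LatL_iff w m 0
  have e : (fun k => Nat.count (fun t => w t = k) 0) = lam 0 0 0 := by
    funext k
    unfold lam
    rcases k with _ | k <;> simp
  rw [e] at h
  rw [h]
  simp

theorem AltL_iff (w : ℕ → ℕ) (m : ℕ) : ∀ s,
    (AltL (decide (Even s)) (w s) ((List.range' (s + 1) m).map w) ↔
      ∀ i, s ≤ i → i < s + m → (w i < w (i + 1) ↔ Even i)) := by
  induction m with
  | zero => intro s; simp [AltL]; intro i h1 h2; omega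
  | succ m ih =>
    intro s
    rw [List.range'_succ, List.map_cons, AltL,
      show (!decide (Even s)) = decide (Even (s + 1)) by
        by_cases h : Even s <;> simp [h, Nat.even_add_one], ih (s + 1)]
    have hc : cmpB (decide (Even s)) (w s) (w (s + 1)) ↔ (w s < w (s + 1) ↔ Even s) := by
      unfold cmpB
      by_cases h : Even s <;> simp [h]
    rw [hc]
    constructor
    · rintro ⟨h1, h2⟩ i hi hi'
      rcases Nat.eq_or_lt_of_le hi with rfl | hlt
      · exact h1
      · exact h2 i hlt (by omega)
    · intro h1
      exact ⟨h1 s le_rfl (by omega), fun i hi hi' => h1 i (by omega) (by omega)⟩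

theorem mem_EE_iff (w : ℕ → ℕ) (m : ℕ) :
    (List.range' 0 (m + 1)).map w ∈ EE (m + 1) false 1 0 0 0 ↔
      (∀ i, i < m + 1 → LocL w i) ∧ ∀ i, i < m → (w i < w (i + 1) ↔ Even i) := by
  rw [mem_EE _ _ _ _ _ _ le_rfl le_rfl, LatL_iff_zero]
  have h := AltL_iff w m 0
  simp only [Nat.zero_le, zero_add, forall_const] at h
  rw [← h]
  rw [List.range'_succ, List.map_cons, AltL]
  simp only [List.length_cons, List.length_map, List.length_range', true_and]
  constructor
  · rintro ⟨h1, h2, h3⟩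
    exact ⟨h1, by simpa using h3⟩
  · rintro ⟨h1, h3⟩
    refine ⟨h1, ?_, by simpa using h3⟩
    obtain ⟨a, -, c⟩ := h1 0 (by omega)
    simp only [Nat.count_zero] at c
    simp only [cmpB]
    by_contra hcon
    simp at hcon
    exact absurd (c hcon) (by omega)

/-- The local conditions give the global ones. -/
theorem part_of_loc (w : ℕ → ℕ) (N : ℕ) (h : ∀ i, i < N → LocL w i) :
    (∀ k, 1 ≤ k → ∀ i, i ≤ N →
      Nat.count (fun s => w s = k + 1) i ≤ Nat.count (fun s => w s = k) i) ∧
    ∀ i, i ≤ N → Nat.count (fun s => w s = 1) i ≤ 3 := by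
  constructor
  · intro k hk i
    induction i with
    | zero => simp
    | succ i ih =>
      intro hi
      have h1 := ih (by omega)
      obtain ⟨-, -, c⟩ := h i (by omega)
      rw [Nat.count_succ, Nat.count_succ]
      by_cases e : w i = k + 1
      · rw [e] at c
        have := c (by omega)
        simp only [Nat.add_sub_cancel] at this
        split_ifs <;> omega
      · rw [if_neg e]; omega
  · intro i
    induction i with
    | zero => simp
    | succ i ih =>
      intro hi
      have h1 := ih (by omega)
      obtain ⟨-, c, -⟩ := h i (by omega)
      rw [Nat.count_succ]
      split_ifs with e
      · have := c e; omega
      · omega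

theorem loc_of_part (w : ℕ → ℕ) (N : ℕ) (hpos : ∀ i, i < N → 1 ≤ w i)
    (h1 : ∀ k, 1 ≤ k → ∀ i, i ≤ N →
      Nat.count (fun s => w s = k + 1) i ≤ Nat.count (fun s => w s = k) i)
    (h2 : Nat.count (fun s => w s = 1) N ≤ 3) : ∀ i, i < N → LocL w i := by
  intro i hi
  refine ⟨hpos i hi, ?_, ?_⟩
  · intro e
    have := Nat.count_monotone (fun s => w s = 1) (show i + 1 ≤ N by omega)
    rw [Nat.count_succ, if_pos e] at this
    omega
  · intro e
    have := h1 (w i - 1) (by omega) (i + 1) (by omega)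
    rw [show w i - 1 + 1 = w i by omega, Nat.count_succ, Nat.count_succ, if_pos rfl,
      if_neg (by omega)] at this
    omega

/-- The growth diagram is determined by its boundary word. -/
theorem gw_determined (p q : ℕ → ℕ) (hp : ∀ i, p (p i) = i) (hq : ∀ i, q (q i) = i) (N : ℕ)
    (hpN : ∀ i, i < N → p i < N) (hqN : ∀ i, i < N → q i < N)
    (h : ∀ i, i < N → gw p i N = gw q i N) : ∀ i, i < N → p i = q i := by
  have back : ∀ p : ℕ → ℕ, (∀ i, p (p i) = i) → ∀ i j, gw p i j =
      if gw p i (j + 1) = gw p j (i + 1) then gw p i (j + 1) - 1 else gw p i (j + 1) := by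
    intro p hp i j
    have h3 : p i = j ↔ p j = i := by
      constructor <;> intro h <;> rw [← h, hp]
    have z1 := gw_pos_iff p hp i j
    have z2 := gw_pos_iff p hp j i
    rw [gw_succ p i j, gw_succ p j i]
    generalize gw p i j = a at *
    generalize gw p j i = v at *
    by_cases hav : a = v
    · subst hav
      by_cases ha : a = 0
      · subst ha
        simp only [if_true]
        split_ifs <;> first | rfl | omega
      · simp [ha]
    · rw [if_neg hav, if_neg (Ne.symm hav), if_neg hav]
  have main : ∀ s i j, (N - i) + (N - j) = s → i < N → j ≤ N → gw p i j = gw q i j := by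
    intro s
    induction s using Nat.strong_induction_on with
    | _ s ih =>
      intro i j hs hi hj
      rcases Nat.eq_or_lt_of_le hj with rfl | hlt
      · exact h i hi
      · have e1 := ih _ (by omega) i (j + 1) rfl hi (by omega)
        have e2 := ih _ (by omega) j (i + 1) rfl (by omega) (by omega)
        rw [back p hp i j, back q hq i j, e1, e2]
  intro i hi
  have hp' := hpN i hi
  have hq' := hqN i hi
  have a1 := main _ i (p i) rfl hi (by omega)
  have a2 := main _ i (q i) rfl hi (by omega)
  have b1 := gw_pos_iff p hp i (p i)
  have b2 := gw_pos_iff p hp i (q i)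
  have b3 := gw_pos_iff q hq i (p i)
  have b4 := gw_pos_iff q hq i (q i)
  rw [a1] at b1
  rw [a2] at b2
  have c1 := b3.1 (b1.2 le_rfl)
  have c2 := b2.1 (b4.2 le_rfl)
  omega

/-- Extension of a permutation of `Fin N` to `ℕ`. -/
def extP {N : ℕ} (π : Equiv.Perm (Fin N)) (i : ℕ) : ℕ :=
  if h : i < N then (π ⟨i, h⟩ : ℕ) else i

theorem extP_lt {N : ℕ} (π : Equiv.Perm (Fin N)) (i : ℕ) (h : i < N) :
    extP π i = (π ⟨i, h⟩ : ℕ) := dif_pos h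

theorem extP_inv {N : ℕ} (π : Equiv.Perm (Fin N)) (hπ : IsInvolution π) (i : ℕ) :
    extP π (extP π i) = i := by
  by_cases h : i < N
  · rw [extP_lt π i h, extP_lt π _ (π ⟨i, h⟩).2]
    simp [hπ ⟨i, h⟩]
  · have : extP π i = i := dif_neg h
    rw [this, this]

theorem contains_iff_Ch {N : ℕ} (π : Equiv.Perm (Fin N)) :
    Contains π p1234 ↔ Ch (extP π) 4 N N := by
  have hid : ∀ a : Fin 4, p1234 a = a := by decide
  constructor
  · rintro ⟨f, hf, hc⟩
    have hs : ∀ a : Fin 4, extP π (f a) = (π (f a) : ℕ) := fun a => extP_lt π _ (f a).2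
    have m : ∀ a b : Fin 4, a < b → (f a : ℕ) < f b ∧ extP π (f a) < extP π (f b) := by
      intro a b hab
      refine ⟨hf hab, ?_⟩
      rw [hs, hs]
      have := (hc a b).2 (by rw [hid, hid]; exact hab)
      exact this
    refine ⟨f 3, (f 3).2, ?_, f 2, (m 2 3 (by decide)).1, (m 2 3 (by decide)).2, f 1,
      (m 1 2 (by decide)).1, (m 1 2 (by decide)).2, f 0,
      (m 0 1 (by decide)).1, (m 0 1 (by decide)).2, trivial⟩
    rw [hs]; exact (π (f 3)).2
  · rintro ⟨d, hd, hd', c, hc, hc', b, hb, hb', a, ha, ha', -⟩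
    have hcN : c < N := by omega
    have hbN : b < N := by omega
    have haN : a < N := by omega
    rw [extP_lt π d hd] at hc'
    rw [extP_lt π c hcN] at hc' hb'
    rw [extP_lt π b hbN] at hb' ha'
    rw [extP_lt π a haN] at ha'
    refine ⟨![⟨a, haN⟩, ⟨b, hbN⟩, ⟨c, hcN⟩, ⟨d, hd⟩], ?_, ?_⟩
    · intro x y hxy
      fin_cases x <;> fin_cases y <;> simp at hxy ⊢ <;> omega
    · intro x y
      rw [hid, hid]
      fin_cases x <;> fin_cases y <;> simp <;>
        first | omega | (rw [Fin.lt_def]; omega) | (rw [Fin.le_def]; omega)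

/-- The boundary word of an involution. -/
def wordOf {N : ℕ} (π : Equiv.Perm (Fin N)) : List ℕ :=
  (List.range' 0 N).map (fun i => gw (extP π) i N)

theorem wordOf_mem (m : ℕ) (π : Equiv.Perm (Fin (m + 1))) (hπ : IsInvolution π) :
    wordOf π ∈ EE (m + 1) false 1 0 0 0 ↔ IsRevAlternating π ∧ Avoids π p1234 := by
  have hp := extP_inv π hπ
  have hpN : ∀ i, i < m + 1 → extP π i < m + 1 := by
    intro i hi; rw [extP_lt π i hi]; exact (π _).2
  unfold wordOf
  rw [mem_EE_iff]
  have hA : (∀ i, i < m → (gw (extP π) i (m + 1) < gw (extP π) (i + 1) (m + 1) ↔ Even i)) ↔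
      IsRevAlternating π := by
    constructor
    · intro h i hi
      have h1 := h i (by omega)
      rw [gw_descent_iff _ hp _ _ (hpN i i.2), extP_lt π i i.2, extP_lt π _ hi] at h1
      rw [Nat.odd_add_one, Nat.not_odd_iff_even, ← h1]
      rfl
    · intro h i hi
      have h1 := h ⟨i, by omega⟩ (by simpa using hi)
      rw [gw_descent_iff _ hp _ _ (hpN i (by omega)), extP_lt π i (by omega),
        extP_lt π _ (by omega)]
      rw [Nat.odd_add_one, Nat.not_odd_iff_even] at h1
      exact h1
  have hC : (∀ i, i < m + 1 → LocL (fun i => gw (extP π) i (m + 1)) i) ↔ Avoids π p1234 := by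
    unfold Avoids
    rw [contains_iff_Ch]
    constructor
    · intro h hc
      have h1 := (part_of_loc _ _ h).2 (m + 1) le_rfl
      have h2 := le_of_Ch _ hp _ _ _ hc
      unfold gL at h2
      omega
    · intro h
      apply loc_of_part
      · intro i hi
        have h1 := gw_pos_iff _ hp i (m + 1)
        have h2 := hpN i hi
        show 1 ≤ gw (extP π) i (m + 1)
        omega
      · intro k hk i _
        exact gL_part _ hp k hk i (m + 1)
      · by_contra hcon
        apply h
        apply Ch_of_le _ hp
        unfold gL
        omega
  rw [hA, hC, and_comm]

theorem wordOf_inj {N : ℕ} (π ρ : Equiv.Perm (Fin N)) (hπ : IsInvolution π)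
    (hρ : IsInvolution ρ) (h : wordOf π = wordOf ρ) : π = ρ := by
  unfold wordOf at h
  rw [List.map_inj_left] at h
  have := gw_determined (extP π) (extP ρ) (extP_inv π hπ) (extP_inv ρ hρ) N
    (fun i hi => by rw [extP_lt π i hi]; exact (π _).2)
    (fun i hi => by rw [extP_lt ρ i hi]; exact (ρ _).2)
    (fun i hi => h i (by simp [hi]))
  ext i
  have h1 := this i i.2
  rw [extP_lt π i i.2, extP_lt ρ i i.2] at h1
  exact h1

theorem wordOf_surj (m : ℕ) (l : List ℕ) (hl : l ∈ EE (m + 1) false 1 0 0 0) :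
    ∃ π : Equiv.Perm (Fin (m + 1)), IsInvolution π ∧ wordOf π = l := by
  have hlen := ((mem_EE _ _ _ _ _ _ le_rfl le_rfl l).1 hl).1
  have hw : (List.range' 0 (m + 1)).map (fun i => l.getD i 0) = l := by
    apply List.ext_getElem
    · simp [hlen]
    · intro i h1 h2
      simp [h2]
  rw [← hw, mem_EE_iff] at hl
  obtain ⟨p, hp, hpN, hpN', hg⟩ := exists_involution (fun i => l.getD i 0) (m + 1)
    (part_of_loc _ _ hl.1).1 (fun i hi => (hl.1 i hi).1)
  let f : Fin (m + 1) → Fin (m + 1) := fun i => ⟨p i, hpN i i.2⟩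
  have hf : ∀ i, f (f i) = i := by
    intro i
    apply Fin.ext
    exact hp i
  let π : Equiv.Perm (Fin (m + 1)) := ⟨f, f, hf, hf⟩
  refine ⟨π, hf, ?_⟩
  have he : extP π = p := by
    funext i
    by_cases h : i < m + 1
    · rw [extP_lt π i h]; rfl
    · rw [hpN' i (by omega)]; exact dif_neg h
  unfold wordOf
  rw [he]
  refine Eq.trans ?_ hw
  apply List.map_congr_left
  intro i hi
  exact hg i (by simpa using hi)

theorem card_words (N : ℕ) (hN : 1 ≤ N) :
    Nat.card {π : Equiv.Perm (Fin N) //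
      IsInvolution π ∧ IsRevAlternating π ∧ Avoids π p1234} = (EE N false 1 0 0 0).card := by
  obtain ⟨m, rfl⟩ : ∃ m, N = m + 1 := ⟨N - 1, by omega⟩
  rw [← Nat.card_eq_finsetCard]
  refine Nat.card_eq_of_bijective
    (fun π => ⟨wordOf π.1, (wordOf_mem m π.1 π.2.1).2 π.2.2⟩) ⟨?_, ?_⟩
  · intro π ρ h
    exact Subtype.ext (wordOf_inj _ _ π.2.1 ρ.2.1 (congrArg Subtype.val h))
  · rintro ⟨l, hl⟩
    obtain ⟨π, hπ, rfl⟩ := wordOf_surj m l hl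
    exact ⟨⟨π, hπ, (wordOf_mem m π hπ).1 hl⟩, rfl⟩

/-- For n ≥ 2, the number of reverse alternating involutions of length 2n
avoiding 1234 is M_{n+1} - 2 M_{n-1} + M_{n-3} (with M_{-1} = 0 when n = 2). -/
theorem card_RAI_even_avoiding_1234 (M : ℕ → ℕ) (hM0 : M 0 = 1)
    (hMrec : ∀ n, M (n + 1) = M n + ∑ k ∈ Finset.range n, M k * M (n - 1 - k))
    (n : ℕ) (hn : 2 ≤ n) :
    (Nat.card {π : Equiv.Perm (Fin (2 * n)) //
      IsInvolution π ∧ IsRevAlternating π ∧ Avoids π p1234} : ℤ) =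
    (M (n + 1) : ℤ) - 2 * (M (n - 1) : ℤ) +
      (if 3 ≤ n then (M (n - 3) : ℤ) else 0) := by
  rw [card_words (2 * n) (by omega)]
  exact cF_answer M hM0 hMrec n hn
end

section
/- The number of reverse alternating involutions of length 2n avoiding the pattern 3412 equals the n-th Motzkin number M_n. -/
/-- Noncrossing involutions of `ℕ`, supported on the pairs `(2i, 2i+1)` with `b ≤ i < e`,
with the opener/closer conditions coming from reverse alternation. -/
structure MP (b e : ℕ) (f : ℕ → ℕ) : Prop where
  inv : ∀ x, f (f x) = x
  out : ∀ x, x < 2 * b ∨ 2 * e ≤ x → f x = x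
  nc : ∀ x y, x < y → y < f x → f y ≤ f x
  od : ∀ i, 2 * i ≤ f (2 * i)
  ev : ∀ i, f (2 * i + 1) ≤ 2 * i + 1
  pr : ∀ i, b ≤ i → i < e → f (2 * i) = 2 * i → f (2 * i + 1) = 2 * i + 1 → False

theorem MP.inside {b e : ℕ} {f : ℕ → ℕ} (h : MP b e f) (x : ℕ) (h1 : 2 * b ≤ x)
    (h2 : x < 2 * e) : 2 * b ≤ f x ∧ f x < 2 * e := by
  by_contra hc
  have := h.out (f x) (by omega)
  have := h.inv x
  omega

def mglue (b c : ℕ) (g h : ℕ → ℕ) (x : ℕ) : ℕ :=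
  if x = 2 * b then 2 * c + 1 else if x = 2 * c + 1 then 2 * b else
    if x < 2 * c then g x else h x

theorem mglue_mem {b c e : ℕ} {g h : ℕ → ℕ} (hbc : b < c) (hce : c < e) (hg : MP (b + 1) c g)
    (hh : MP (c + 1) e h) : MP b e (mglue b c g h) := by
  have g1 := hg.inside
  have h1 := hh.inside
  obtain ⟨gi, go, gn, god, gev, gp⟩ := hg
  obtain ⟨hi, ho, hn, hod, hev, hp⟩ := hh
  -- evaluation lemmas
  have e1 : mglue b c g h (2 * b) = 2 * c + 1 := by simp [mglue]
  have e2 : mglue b c g h (2 * c + 1) = 2 * b := by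
    simp only [mglue]; split_ifs <;> omega
  have e3 : ∀ x, 2 * (b + 1) ≤ x → x < 2 * c → mglue b c g h x = g x := by
    intro x _ _; simp only [mglue]; split_ifs <;> omega
  have e4 : ∀ x, 2 * (c + 1) ≤ x → x < 2 * e → mglue b c g h x = h x := by
    intro x _ _; simp only [mglue]; split_ifs <;> omega
  have e5 : ∀ x, x < 2 * b ∨ x = 2 * b + 1 ∨ x = 2 * c ∨ 2 * e ≤ x → mglue b c g h x = x := by
    intro x hx
    have := go x
    have := ho x
    simp only [mglue]; split_ifs <;> omega
  have cs : ∀ x, x = 2 * b ∨ x = 2 * c + 1 ∨ (2 * (b + 1) ≤ x ∧ x < 2 * c) ∨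
      (2 * (c + 1) ≤ x ∧ x < 2 * e) ∨
      (x < 2 * b ∨ x = 2 * b + 1 ∨ x = 2 * c ∨ 2 * e ≤ x) := by omega
  generalize mglue b c g h = f at *
  refine ⟨?_, ?_, ?_, ?_, ?_, ?_⟩
  · intro x
    rcases cs x with rfl | rfl | ⟨u, v⟩ | ⟨u, v⟩ | u
    · rw [e1, e2]
    · rw [e2, e1]
    · rw [e3 x u v, e3 _ (g1 x u v).1 (g1 x u v).2, gi]
    · rw [e4 x u v, e4 _ (h1 x u v).1 (h1 x u v).2, hi]
    · rw [e5 x u, e5 x u]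
  · intro x hx
    exact e5 x (by omega)
  · intro x y hxy hy
    have gx := g1 x
    have gy := g1 y
    have hx' := h1 x
    have hy' := h1 y
    have a1 := gn x y hxy
    have a2 := hn x y hxy
    rcases cs x with rfl | rfl | ⟨u, v⟩ | ⟨u, v⟩ | u <;>
    rcases cs y with rfl | rfl | ⟨u', v'⟩ | ⟨u', v'⟩ | u' <;>
    simp only [*] at hy ⊢ <;> first | omega | grind
  · intro i
    have := god i
    have := hod i
    rcases cs (2 * i) with u | u | ⟨u, v⟩ | ⟨u, v⟩ | u
    · rw [u, e1]; omega
    · omega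
    · rw [e3 _ u v]; omega
    · rw [e4 _ u v]; omega
    · rw [e5 _ u]
  · intro i
    have := gev i
    have := hev i
    rcases cs (2 * i + 1) with u | u | ⟨u, v⟩ | ⟨u, v⟩ | u
    · omega
    · rw [u, e2]; omega
    · rw [e3 _ u v]; omega
    · rw [e4 _ u v]; omega
    · rw [e5 _ u]
  · intro i hi1 hi2 p1 p2
    have q1 := gp i
    have q2 := hp i
    by_cases k1 : i = b
    · subst k1; omega
    by_cases k2 : i = c
    · subst k2; omega
    by_cases k3 : i < c
    · rw [e3 _ (by omega) (by omega)] at p1 p2; exact q1 (by omega) (by omega) p1 p2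
    · rw [e4 _ (by omega) (by omega)] at p1 p2; exact q2 (by omega) (by omega) p1 p2

theorem mglue_mem_flat {b e : ℕ} {h : ℕ → ℕ} (hbe : b < e)
    (hh : MP (b + 1) e h) : MP b e (mglue b b id h) := by
  have h1 := hh.inside
  obtain ⟨hi, ho, hn, hod, hev, hp⟩ := hh
  have e1 : mglue b b id h (2 * b) = 2 * b + 1 := by simp [mglue]
  have e2 : mglue b b id h (2 * b + 1) = 2 * b := by
    simp only [mglue]; split_ifs <;> omega
  have e4 : ∀ x, 2 * (b + 1) ≤ x → x < 2 * e → mglue b b id h x = h x := by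
    intro x _ _; simp only [mglue]; split_ifs <;> omega
  have e5 : ∀ x, x < 2 * b ∨ 2 * e ≤ x → mglue b b id h x = x := by
    intro x hx
    have := ho x
    simp only [mglue, id]; split_ifs <;> omega
  have cs : ∀ x, x = 2 * b ∨ x = 2 * b + 1 ∨ (2 * (b + 1) ≤ x ∧ x < 2 * e) ∨
      (x < 2 * b ∨ 2 * e ≤ x) := by omega
  generalize mglue b b id h = f at *
  refine ⟨?_, ?_, ?_, ?_, ?_, ?_⟩
  · intro x
    rcases cs x with rfl | rfl | ⟨u, v⟩ | u
    · rw [e1, e2]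
    · rw [e2, e1]
    · rw [e4 x u v, e4 _ (h1 x u v).1 (h1 x u v).2, hi]
    · rw [e5 x u, e5 x u]
  · exact e5
  · intro x y hxy hy
    have hx' := h1 x
    have hy' := h1 y
    have a2 := hn x y hxy
    rcases cs x with rfl | rfl | ⟨u, v⟩ | u <;>
    rcases cs y with rfl | rfl | ⟨u', v'⟩ | u' <;>
    simp only [*] at hy ⊢ <;> first | omega | grind
  · intro i
    have := hod i
    rcases cs (2 * i) with u | u | ⟨u, v⟩ | u
    · rw [u, e1]; omega
    · omega
    · rw [e4 _ u v]; omega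
    · rw [e5 _ u]
  · intro i
    have := hev i
    rcases cs (2 * i + 1) with u | u | ⟨u, v⟩ | u
    · omega
    · rw [u, e2]; omega
    · rw [e4 _ u v]; omega
    · rw [e5 _ u]
  · intro i hi1 hi2 p1 p2
    have q2 := hp i
    by_cases k1 : i = b
    · subst k1; omega
    · rw [e4 _ (by omega) (by omega)] at p1 p2; exact q2 (by omega) (by omega) p1 p2

/-- Restriction to a set of pairs. -/
def mrestr (b e : ℕ) (f : ℕ → ℕ) (x : ℕ) : ℕ :=
  if 2 * b ≤ x ∧ x < 2 * e then f x else x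

theorem mrestr_mem {b e b' e' : ℕ} {f : ℕ → ℕ} (hf : MP b e f) (hb : b ≤ b') (he : e' ≤ e)
    (hin : ∀ x, 2 * b' ≤ x → x < 2 * e' → 2 * b' ≤ f x ∧ f x < 2 * e') :
    MP b' e' (mrestr b' e' f) := by
  obtain ⟨hi, ho, hn, hod, hev, hp⟩ := hf
  have e1 : ∀ x, 2 * b' ≤ x → x < 2 * e' → mrestr b' e' f x = f x := by
    intro x _ _; simp only [mrestr]; split_ifs <;> omega
  have e2 : ∀ x, x < 2 * b' ∨ 2 * e' ≤ x → mrestr b' e' f x = x := by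
    intro x _; simp only [mrestr]; split_ifs <;> omega
  have cs : ∀ x, (2 * b' ≤ x ∧ x < 2 * e') ∨ (x < 2 * b' ∨ 2 * e' ≤ x) := by omega
  generalize mrestr b' e' f = g at *
  refine ⟨?_, e2, ?_, ?_, ?_, ?_⟩
  · intro x
    rcases cs x with ⟨u, v⟩ | u
    · rw [e1 x u v, e1 _ (hin x u v).1 (hin x u v).2, hi]
    · rw [e2 x u, e2 x u]
  · intro x y hxy hy
    have hx' := hin x
    have a2 := hn x y hxy
    rcases cs x with ⟨u, v⟩ | u
    · rw [e1 x u v] at hy ⊢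
      rw [e1 y (by omega) (by omega)]
      omega
    · rw [e2 x u] at hy; omega
  · intro i
    have := hod i
    rcases cs (2 * i) with ⟨u, v⟩ | u
    · rw [e1 _ u v]; omega
    · rw [e2 _ u]
  · intro i
    have := hev i
    rcases cs (2 * i + 1) with ⟨u, v⟩ | u
    · rw [e1 _ u v]; omega
    · rw [e2 _ u]
  · intro i h1 h2 p1 p2
    rw [e1 _ (by omega) (by omega)] at p1 p2
    exact hp i (by omega) (by omega) p1 p2

theorem MP.first {b e : ℕ} {f : ℕ → ℕ} (hf : MP b e f) (hbe : b < e) :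
    ∃ c, b ≤ c ∧ c < e ∧ f (2 * b) = 2 * c + 1 := by
  have h1 := hf.inside (2 * b) (by omega) (by omega)
  have h2 := hf.inside (2 * b + 1) (by omega) (by omega)
  have h3 := hf.ev b
  have h4 := hf.pr b le_rfl hbe
  have h5 := hf.inv (2 * b)
  have h6 := hf.inv (2 * b + 1)
  have hne : f (2 * b) ≠ 2 * b := by
    intro h
    have : f (2 * b + 1) = 2 * b ∨ f (2 * b + 1) = 2 * b + 1 := by omega
    rcases this with h' | h'
    · rw [h', h] at h6; omega
    · exact h4 h h'
  rcases Nat.even_or_odd' (f (2 * b)) with ⟨c, hc | hc⟩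
  · have := hf.od c
    rw [← hc, h5] at this
    omega
  · exact ⟨c, by omega, by omega, hc⟩

theorem MP.decomp {b c e : ℕ} {f : ℕ → ℕ} (hf : MP b e f) (hbc : b ≤ c) (hce : c < e)
    (hc : f (2 * b) = 2 * c + 1) :
    MP (c + 1) e (mrestr (c + 1) e f) ∧ (b < c → MP (b + 1) c (mrestr (b + 1) c f) ∧
      mglue b c (mrestr (b + 1) c f) (mrestr (c + 1) e f) = f) ∧
    (b = c → mglue b c id (mrestr (c + 1) e f) = f) := by
  have hc' : f (2 * c + 1) = 2 * b := by rw [← hc, hf.inv]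
  have inj : ∀ x y, f x = f y → x = y := by
    intro x y h
    rw [← hf.inv x, h, hf.inv]
  have hin1 : ∀ x, 2 * (c + 1) ≤ x → x < 2 * e → 2 * (c + 1) ≤ f x ∧ f x < 2 * e := by
    intro x h1 h2
    have h3 := hf.inside x (by omega) h2
    refine ⟨?_, h3.2⟩
    by_contra hlt
    have h4 : f x ≠ 2 * b := fun h => by
      have := inj x (2 * c + 1) (by rw [h, hc']); omega
    have h5 : f x ≠ 2 * c + 1 := fun h => by
      have := inj x (2 * b) (by rw [h, hc]); omega
    have := hf.nc (2 * b) (f x) (by omega) (by omega)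
    rw [hf.inv] at this
    omega
  have m1 := mrestr_mem hf (b' := c + 1) (e' := e) (by omega) le_rfl hin1
  refine ⟨m1, ?_, ?_⟩
  · intro hlt
    have f1 : f (2 * b + 1) = 2 * b + 1 := by
      have h1 := hf.inside (2 * b + 1) (by omega) (by omega)
      have h2 := hf.ev b
      have h3 : f (2 * b + 1) ≠ 2 * b := fun h => by
        have := inj (2 * b + 1) (2 * c + 1) (by rw [h, hc']); omega
      omega
    have f2 : f (2 * c) = 2 * c := by
      have h1 := hf.od c
      have h2 := hf.nc (2 * b) (2 * c) (by omega) (by omega)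
      have h3 : f (2 * c) ≠ 2 * c + 1 := fun h => by
        have := inj (2 * c) (2 * b) (by rw [h, hc]); omega
      omega
    have hin2 : ∀ x, 2 * (b + 1) ≤ x → x < 2 * c → 2 * (b + 1) ≤ f x ∧ f x < 2 * c := by
      intro x h1 h2
      have h3 := hf.inside x (by omega) (by omega)
      have h4 := hf.nc (2 * b) x (by omega) (by omega)
      have n1 : f x ≠ 2 * b := fun h => by
        have := inj x (2 * c + 1) (by rw [h, hc']); omega
      have n2 : f x ≠ 2 * c + 1 := fun h => by
        have := inj x (2 * b) (by rw [h, hc]); omega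
      have n3 : f x ≠ 2 * b + 1 := fun h => by
        have := inj x (2 * b + 1) (by rw [h, f1]); omega
      have n4 : f x ≠ 2 * c := fun h => by
        have := inj x (2 * c) (by rw [h, f2]); omega
      omega
    refine ⟨mrestr_mem hf (by omega) (by omega) hin2, ?_⟩
    funext x
    have k1 : x = 2 * b → f x = 2 * c + 1 := by rintro rfl; exact hc
    have k2 : x = 2 * c + 1 → f x = 2 * b := by rintro rfl; exact hc'
    have k3 : x = 2 * b + 1 → f x = x := by rintro rfl; exact f1
    have k4 : x = 2 * c → f x = x := by rintro rfl; exact f2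
    have ho := hf.out x
    simp only [mglue, mrestr]
    split_ifs <;> omega
  · intro hlt
    subst hlt
    funext x
    have k1 : x = 2 * b → f x = 2 * b + 1 := by rintro rfl; exact hc
    have k2 : x = 2 * b + 1 → f x = 2 * b := by rintro rfl; exact hc'
    have ho := hf.out x
    simp only [mglue, mrestr, id]
    split_ifs <;> omega

abbrev MS (b e : ℕ) := {f : ℕ → ℕ // MP b e f}

def mmap (b n : ℕ) : MS (b + 1) (b + 1 + n) ⊕
    (Σ k : Fin n, MS (b + 1) (b + 1 + k) × MS (b + 1 + k + 1) (b + 1 + n)) →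
    MS b (b + 1 + n)
  | .inl h => ⟨mglue b b id h.1, mglue_mem_flat (by omega) h.2⟩
  | .inr ⟨k, g, h⟩ => ⟨mglue b (b + 1 + k) g.1 h.1, mglue_mem (by omega) (by omega) g.2 h.2⟩

theorem mglue_inj_right {b c e : ℕ} {g g' h h' : ℕ → ℕ} (hbc : b ≤ c) (hh : MP (c + 1) e h)
    (hh' : MP (c + 1) e h') (heq : mglue b c g h = mglue b c g' h') : h = h' := by
  funext x
  have h1 := congrFun heq x
  have h2 := hh.out x
  have h3 := hh'.out x
  simp only [mglue] at h1
  by_cases hx : x < 2 * (c + 1)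
  · rw [h2 (by omega), h3 (by omega)]
  · split_ifs at h1 <;> omega

theorem mglue_inj_left {b c : ℕ} {g g' h h' : ℕ → ℕ} (hg : MP (b + 1) c g)
    (hg' : MP (b + 1) c g') (heq : mglue b c g h = mglue b c g' h') : g = g' := by
  funext x
  have h1 := congrFun heq x
  have h2 := hg.out x
  have h3 := hg'.out x
  simp only [mglue] at h1
  by_cases hx : 2 * (b + 1) ≤ x ∧ x < 2 * c
  · split_ifs at h1 <;> omega
  · rw [h2 (by omega), h3 (by omega)]

theorem mmap_bij (b n : ℕ) : Function.Bijective (mmap b n) := by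
  constructor
  · rintro (h | ⟨k, g, h⟩) (h' | ⟨k', g', h'⟩) heq
    · have heq := congrArg Subtype.val heq
      simp only [mmap] at heq
      rw [Subtype.ext (mglue_inj_right le_rfl h.2 h'.2 heq)]
    · have heq := congrFun (congrArg Subtype.val heq) (2 * b)
      simp [mmap, mglue] at heq
      omega
    · have heq := congrFun (congrArg Subtype.val heq) (2 * b)
      simp [mmap, mglue] at heq
      omega
    · have heq := congrArg Subtype.val heq
      have hk := congrFun heq (2 * b)
      simp [mmap, mglue] at hk
      have hk : k = k' := by omega
      subst hk
      simp only [mmap] at heq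
      rw [Subtype.ext (mglue_inj_right (by omega) h.2 h'.2 heq),
        Subtype.ext (mglue_inj_left g.2 g'.2 heq)]
  · rintro ⟨f, hf⟩
    obtain ⟨c, h1, h2, h3⟩ := hf.first (by omega)
    obtain ⟨m1, m2, m3⟩ := hf.decomp h1 h2 h3
    rcases Nat.eq_or_lt_of_le h1 with rfl | hlt
    · exact ⟨.inl ⟨_, m1⟩, Subtype.ext (m3 rfl)⟩
    · obtain ⟨k, rfl⟩ := Nat.exists_eq_add_of_le (show b + 1 ≤ c by omega)
      exact ⟨.inr ⟨⟨k, by omega⟩, ⟨_, (m2 hlt).1⟩, ⟨_, m1⟩⟩, Subtype.ext (m2 hlt).2⟩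

theorem MP_zero (b : ℕ) (f : ℕ → ℕ) : MP b b f ↔ f = id := by
  constructor
  · intro h
    funext x
    exact h.out x (by omega)
  · rintro rfl
    constructor <;> simp <;> omega

theorem MS_card (M : ℕ → ℕ) (hM0 : M 0 = 1)
    (hMrec : ∀ n, M (n + 1) = M n + ∑ k ∈ Finset.range n, M k * M (n - 1 - k)) (n : ℕ) :
    ∀ b e, e = b + n → Finite (MS b e) ∧ Nat.card (MS b e) = M n := by
  induction n using Nat.strong_induction_on with
  | _ n ih =>
    rintro b e rfl
    cases n with
    | zero =>
      have : Unique (MS b (b + 0)) :=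
        { default := ⟨id, (MP_zero b id).2 rfl⟩
          uniq := fun f => Subtype.ext ((MP_zero b _).1 f.2) }
      exact ⟨inferInstance, by rw [hM0]; exact Nat.card_unique⟩
    | succ n =>
      rw [show b + (n + 1) = b + 1 + n by omega]
      have hbij := mmap_bij b n
      have i1 := ih n (by omega) (b + 1) (b + 1 + n) rfl
      have i2 := fun k : Fin n => ih k (by omega) (b + 1) (b + 1 + k) rfl
      have i3 := fun k : Fin n => ih (n - 1 - k) (by omega) (b + 1 + k + 1) (b + 1 + n) (by omega)
      have := i1.1
      have := fun k => (i2 k).1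
      have := fun k => (i3 k).1
      refine ⟨Finite.of_surjective _ hbij.2, ?_⟩
      rw [← Nat.card_eq_of_bijective _ hbij, Nat.card_sum, Nat.card_sigma, i1.2, hMrec,
        Finset.sum_range]
      congr 1
      refine Finset.sum_congr rfl fun k _ => ?_
      rw [Nat.card_prod, (i2 k).2, (i3 k).2]

/-- extension of a permutation of `Fin m` to `ℕ`. -/
def pext {m : ℕ} (π : Equiv.Perm (Fin m)) (x : ℕ) : ℕ :=
  if h : x < m then π ⟨x, h⟩ else x

theorem pext_lt {m : ℕ} (π : Equiv.Perm (Fin m)) (x : ℕ) (h : x < m) : pext π x < m := by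
  simp [pext, h]

theorem pext_fin {m : ℕ} (π : Equiv.Perm (Fin m)) (x : Fin m) : (π x : ℕ) = pext π x := by
  simp [pext]

theorem avoids_iff {m : ℕ} (π : Equiv.Perm (Fin m)) (hi : IsInvolution π) :
    Avoids π p3412 ↔ ∀ x y, x < y → y < pext π x → pext π y ≤ pext π x := by
  have inv : ∀ x, pext π (pext π x) = x := by
    intro x
    by_cases h : x < m
    · have := hi ⟨x, h⟩
      rw [Fin.ext_iff, pext_fin, pext_fin] at this
      exact this
    · simp [pext, h]
  constructor
  · intro ha x y hxy hy
    by_contra hc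
    apply ha
    have hxm : x < m := by
      by_contra h
      simp [pext, h] at hy; omega
    have hym : y < m := by
      have := pext_lt π x hxm
      omega
    refine ⟨![⟨x, hxm⟩, ⟨y, hym⟩, ⟨pext π x, pext_lt π x hxm⟩, ⟨pext π y, pext_lt π y hym⟩], ?_, ?_⟩
    · rw [Fin.strictMono_iff_lt_succ]
      intro i
      fin_cases i <;> simp [Fin.lt_def] <;> omega
    · intro a b
      have e1 := inv x
      have e2 := inv y
      fin_cases a <;> fin_cases b <;> simp [Fin.lt_def, pext_fin, p3412, e1, e2] <;> omega
  · rintro hn ⟨f, hf, hp⟩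
    have a1 : (f 0 : ℕ) < f 1 := hf (by decide)
    have a2 : (f 1 : ℕ) < f 2 := hf (by decide)
    have a3 : (f 2 : ℕ) < f 3 := hf (by decide)
    have b1 := (hp 2 3).2 (by decide)
    have b2 := (hp 3 0).2 (by decide)
    have b3 := (hp 0 1).2 (by decide)
    rw [Fin.lt_def, pext_fin, pext_fin] at b1 b2 b3
    by_cases h : (f 1 : ℕ) < pext π (f 0)
    · have := hn _ _ a1 h
      omega
    · have := hn _ _ b1 (by rw [inv]; omega)
      rw [inv, inv] at this
      omega

theorem pext_MP {n : ℕ} (π : Equiv.Perm (Fin (2 * n))) :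
    (IsInvolution π ∧ IsRevAlternating π ∧ Avoids π p3412) ↔ MP 0 n (pext π) := by
  have hinv : IsInvolution π ↔ ∀ x, pext π (pext π x) = x := by
    constructor
    · intro hi x
      by_cases h : x < 2 * n
      · have := hi ⟨x, h⟩
        rw [Fin.ext_iff, pext_fin, pext_fin] at this
        exact this
      · simp [pext, h]
    · intro h i
      rw [Fin.ext_iff, pext_fin, pext_fin, h]
  have hra : IsRevAlternating π ↔
      ∀ i, i + 1 < 2 * n → (pext π (i + 1) < pext π i ↔ i % 2 = 0) := by
    constructor
    · intro h i hi
      have := h ⟨i, by omega⟩ hi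
      rw [Fin.lt_def, pext_fin, pext_fin, Nat.odd_iff] at this
      simp only at this
      rw [this]; omega
    · intro h i hi
      rw [Fin.lt_def, pext_fin, pext_fin, Nat.odd_iff]
      simp only
      rw [h i hi]; omega
  have hout : ∀ x, 2 * n ≤ x → pext π x = x := by
    intro x hx
    simp [pext, hx]
  have hlt := pext_lt π
  have hav := avoids_iff π
  constructor
  · rintro ⟨h1, h2, h3⟩
    rw [hav h1] at h3
    rw [hinv] at h1
    rw [hra] at h2
    clear hinv hra hav
    generalize pext π = f at *
    refine ⟨h1, fun x hx => hout x (by omega), h3, ?_, ?_, ?_⟩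
    · intro i
      by_contra hc
      by_cases hin : 2 * i < 2 * n
      · obtain ⟨j, rfl⟩ : ∃ j, i = j + 1 := ⟨i - 1, by omega⟩
        have a := h2 (2 * j + 1) (by omega)
        rw [show 2 * j + 1 + 1 = 2 * (j + 1) by ring] at a
        have i1 := h1 (2 * j + 1)
        have i2 := h1 (2 * (j + 1))
        have b := h3 (f (2 * j + 1)) (f (2 * (j + 1)))
        rw [i1, i2] at b
        by_cases e1 : f (2 * (j + 1)) = 2 * j + 1
        · rw [e1] at i2; omega
        by_cases e2 : f (2 * j + 1) = f (2 * (j + 1))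
        · rw [e2] at i1; omega
        omega
      · have := hout (2 * i) (by omega); omega
    · intro i
      by_contra hc
      by_cases hin : 2 * i + 1 < 2 * n
      · have l := hlt (2 * i + 1) hin
        have a := h2 (2 * i + 1) (by omega)
        have b := h3 (2 * i + 1) (2 * i + 1 + 1) (by omega)
        have i1 := h1 (2 * i + 1)
        have i2 := h1 (2 * i + 1 + 1)
        by_cases e1 : f (2 * i + 1) = 2 * i + 1 + 1
        · rw [e1] at i1; omega
        by_cases e2 : f (2 * i + 1) = f (2 * i + 1 + 1)
        · rw [e2] at i1; omega
        omega
      · have := hout (2 * i + 1) (by omega); omega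
    · intro i _ hi p1 p2
      have := h2 (2 * i) (by omega)
      omega
  · intro h
    obtain ⟨h1, h2, h3, h4, h5, h6⟩ := h
    have hI := hinv.2 h1
    refine ⟨hI, hra.2 ?_, (hav hI).2 h3⟩
    clear hinv hra hav
    generalize pext π = f at *
    intro i hi
    rcases Nat.even_or_odd' i with ⟨j, rfl | rfl⟩
    · have a1 := h4 j
      have a2 := h5 j
      have a3 := h6 j (by omega) (by omega)
      have : f (2 * j + 1) < f (2 * j) := by
        by_cases e : f (2 * j) = 2 * j
        · have i1 := h1 (2 * j)
          have i2 := h1 (2 * j + 1)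
          by_cases e' : f (2 * j + 1) = 2 * j
          · rw [e', e] at i2; omega
          · have : f (2 * j + 1) ≠ 2 * j + 1 := fun h => a3 e h
            omega
        · have i1 := h1 (2 * j)
          by_cases e' : f (2 * j) = f (2 * j + 1)
          · have := h1 (2 * j + 1)
            rw [← e'] at this; omega
          · omega
      omega
    · have a1 := h5 j
      have a2 := h4 (j + 1)
      rw [show 2 * (j + 1) = 2 * j + 1 + 1 by ring] at a2
      omega

theorem pext_surj {m : ℕ} (f : ℕ → ℕ) (hinv : ∀ x, f (f x) = x)
    (hout : ∀ x, m ≤ x → f x = x) : ∃ π : Equiv.Perm (Fin m), pext π = f := by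
  have hl : ∀ x, x < m → f x < m := by
    intro x hx
    by_contra h
    have h1 := hout (f x) (by omega)
    have h2 := hinv x
    omega
  refine ⟨⟨fun x => ⟨f x, hl x x.2⟩, fun x => ⟨f x, hl x x.2⟩, ?_, ?_⟩, ?_⟩
  · intro x; simp [hinv]
  · intro x; simp [hinv]
  · funext x
    by_cases h : x < m
    · simp [pext, h]
    · simp [pext, h, hout x (by omega)]

/-- The number of reverse alternating involutions of length 2n avoiding 3412
is the n-th Motzkin number. -/
theorem card_RAI_even_avoiding_3412 (M : ℕ → ℕ) (hM0 : M 0 = 1)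
    (hMrec : ∀ n, M (n + 1) = M n + ∑ k ∈ Finset.range n, M k * M (n - 1 - k))
    (n : ℕ) :
    Nat.card {π : Equiv.Perm (Fin (2 * n)) //
      IsInvolution π ∧ IsRevAlternating π ∧ Avoids π p3412} = M n := by
  rw [← (MS_card M hM0 hMrec n 0 n (by omega)).2]
  refine Nat.card_eq_of_bijective
    (fun π => (⟨pext π.1, (pext_MP π.1).1 π.2⟩ : MS 0 n)) ⟨?_, ?_⟩
  · intro π σ h
    have h := congrArg Subtype.val h
    apply Subtype.ext
    ext x
    rw [pext_fin, pext_fin]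
    exact congrFun h x
  · rintro ⟨f, hf⟩
    obtain ⟨π, rfl⟩ := pext_surj (m := 2 * n) f hf.inv (fun x hx => hf.out x (by omega))
    exact ⟨⟨π, (pext_MP π).2 hf⟩, rfl⟩
end

section
/- For n ≥ 1, the number of reverse alternating involutions of length 2n+1 avoiding both patterns 2431 and 4132 equals ⌊(5·2^{n−1})/3⌋. -/
/-- Function model of the objects counted. -/
def Good (N : ℕ) (f : ℕ → ℕ) : Prop :=
  (∀ i, f (f i) = i) ∧ (∀ i, N ≤ i → f i = i) ∧
  (∀ i, i + 1 < N → (f (i + 1) < f i ↔ i % 2 = 0)) ∧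
  ∀ i j k l, i < j → j < k → k < l → f l < f i → f i < f k → f k < f j → False

namespace Good
variable {N : ℕ} {f : ℕ → ℕ}

lemma inv (h : Good N f) (i : ℕ) : f (f i) = i := h.1 i
lemma inj (h : Good N f) {i j : ℕ} (e : f i = f j) : i = j := by
  rw [← h.1 i, e, h.1]
lemma out (h : Good N f) {i : ℕ} (hi : N ≤ i) : f i = i := h.2.1 i hi
lemma lt (h : Good N f) {i : ℕ} (hi : i < N) : f i < N := by
  by_contra hc
  have h1 := h.out (not_lt.mp hc)
  rw [h.inv] at h1
  omega
lemma desc (h : Good N f) {i : ℕ} (hi : i + 1 < N) (e : i % 2 = 0) : f (i + 1) < f i :=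
  (h.2.2.1 i hi).2 e
lemma asc (h : Good N f) {i : ℕ} (hi : i + 1 < N) (e : i % 2 = 1) : f i < f (i + 1) := by
  have h1 := h.2.2.1 i hi
  have h2 : f i ≠ f (i + 1) := fun e' => by have := h.inj e'; omega
  have h3 : ¬ f (i + 1) < f i := by rw [h1]; omega
  omega
lemma a2431 (h : Good N f) {i j k l : ℕ} (h1 : i < j) (h2 : j < k) (h3 : k < l)
    (h4 : f l < f i) (h5 : f i < f k) (h6 : f k < f j) : False :=
  h.2.2.2 i j k l h1 h2 h3 h4 h5 h6
lemma a4132 (h : Good N f) {i j k l : ℕ} (h1 : i < j) (h2 : j < k) (h3 : k < l)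
    (h4 : f j < f l) (h5 : f l < f k) (h6 : f k < f i) : False :=
  h.2.2.2 (f j) (f l) (f k) (f i) h4 h5 h6 (by rwa [h.inv, h.inv]) (by rwa [h.inv, h.inv])
    (by rwa [h.inv, h.inv])

/-- Valleys decrease after a position whose value dominates. -/
lemma valley (h : Good N f) {M : ℕ} (hM : ∀ i, M < i → i < N → f i < f M) :
    ∀ t i, i % 2 = 1 → M < i → i + 2 * t < N → f (i + 2 * t) + t ≤ f i := by
  intro t
  induction t with
  | zero => intro i _ _ _; simp
  | succ t ih =>
    intro i hi hMi hN
    have h1 := ih i hi hMi (by omega)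
    have h2 : f (i + 2 * (t + 1)) < f (i + 2 * t) := by
      by_contra hc
      have hne : f (i + 2 * (t + 1)) ≠ f (i + 2 * t) := fun e => by have := h.inj e; omega
      have h3 : f (i + 2 * t + 1 + 1) < f (i + 2 * t + 1) := h.desc (by omega) (by omega)
      exact h.a4132 (i := M) (j := i + 2 * t) (k := i + 2 * t + 1) (l := i + 2 * (t + 1))
        (by omega) (by omega) (by omega) (by omega) h3 (hM _ (by omega) (by omega))
    omega

lemma valley' (h : Good N f) {M : ℕ} (hM : ∀ i, M < i → i < N → f i < f M) {i j : ℕ}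
    (hi : i % 2 = 1) (hj : j % 2 = 1) (hMi : M < i) (hij : i ≤ j) (hN : j < N) : f j ≤ f i := by
  have := h.valley hM ((j - i) / 2) i hi hMi (by omega)
  rw [show i + 2 * ((j - i) / 2) = j by omega] at this
  omega

/-- Structure of the even case, first part. -/
lemma even1 {n : ℕ} (h : Good (2 * n) f) (hn : 1 ≤ n) :
    ∃ m < n, f (2 * n - 1) = 2 * m ∧ (∀ i, i < 2 * m → f i < 2 * m) ∧
      ∀ i, 2 * m ≤ i → i < 2 * n → 2 * m ≤ f i := by
  obtain ⟨p, hp⟩ : ∃ p, p = f (2 * n - 1) := ⟨_, rfl⟩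
  have hfp : f p = 2 * n - 1 := by rw [hp, h.inv]
  have hpl : p < 2 * n := by rw [hp]; exact h.lt (by omega)
  have hpe : p % 2 = 0 := by
    by_contra hc
    have h1 := h.desc (i := p - 1) (by omega) (by omega)
    rw [show p - 1 + 1 = p by omega] at h1
    have := h.lt (i := p - 1) (by omega)
    omega
  have hmax : ∀ i, p < i → i < 2 * n → f i < f p := by
    intro i h1 h2
    have h3 := h.lt h2
    have h4 : f i ≠ f p := fun e => by have := h.inj e; omega
    omega
  have hodd : ∀ i, i % 2 = 1 → p < i → i < 2 * n → p ≤ f i := by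
    intro i h1 h2 h3
    have := h.valley' hmax h1 (j := 2 * n - 1) (by omega) h2 (by omega) (by omega)
    omega
  have hall : ∀ i, p ≤ i → i < 2 * n → p ≤ f i := by
    intro i h1 h2
    rcases eq_or_lt_of_le h1 with rfl | h3
    · omega
    · by_cases hi : i % 2 = 1
      · exact hodd i hi h3 h2
      · have h4 := hodd (i - 1) (by omega) (by omega) (by omega)
        have h5 := h.asc (i := i - 1) (by omega) (by omega)
        rw [show i - 1 + 1 = i by omega] at h5
        omega
  refine ⟨p / 2, by omega, by omega, ?_, ?_⟩
  · intro i hi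
    by_contra hc
    have := hall (f i) (by omega) (h.lt (by omega))
    rw [h.inv] at this
    omega
  · intro i h1 h2
    have := hall i (by omega) h2
    omega
end Good

/-- The indecomposable even block on `[2m, 2n)`. -/
def blk (m n i : ℕ) : ℕ :=
  if i = 2 * m then 2 * n - 1 else if i = 2 * n - 1 then 2 * m
  else if i % 2 = 1 then 2 * m + 2 * n - 2 - i else 2 * m + 2 * n - i

lemma even2 {n m : ℕ} {f : ℕ → ℕ} (h : Good (2 * n) f) (hmn : m < n) (hl : f (2 * n - 1) = 2 * m)
    (hge : ∀ i, 2 * m ≤ i → i < 2 * n → 2 * m ≤ f i) :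
    ∀ j, 1 ≤ j → m + j < n →
      f (2 * m + 2 * j - 1) = 2 * n - 1 - 2 * j ∧ f (2 * m + 2 * j) = 2 * n - 2 * j := by
  have hf : f (2 * m) = 2 * n - 1 := by rw [← hl, h.inv]
  have hmax : ∀ i, 2 * m < i → i < 2 * n → f i < f (2 * m) := by
    intro i h1 h2
    have h3 := h.lt h2
    have h4 : f i ≠ f (2 * m) := fun e => by have := h.inj e; omega
    omega
  intro j
  induction j using Nat.strong_induction_on with
  | _ j ih =>
  intro hj hjn
  by_cases hlow : m + 2 * j ≤ n
  · -- the window is preserved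
    have hW : ∀ i, 2 * m + 2 * j - 1 ≤ i → i ≤ 2 * n - 2 * j →
        2 * m + 2 * j - 1 ≤ f i ∧ f i ≤ 2 * n - 2 * j := by
      intro i h1 h2
      have h3 := hge i (by omega) (by omega)
      have h4 := h.lt (i := i) (by omega)
      have key : ∀ v, 2 * m ≤ v → v < 2 * n → v < 2 * m + 2 * j - 1 ∨ 2 * n - 2 * j < v →
          f v < 2 * m + 2 * j - 1 ∨ 2 * n - 2 * j < f v := by
        intro v hv1 hv2 hv3
        by_cases e1 : v = 2 * m
        · subst e1; omega
        by_cases e2 : v = 2 * n - 1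
        · subst e2; omega
        rcases hv3 with hv3 | hv3
        · have := ih ((v + 1 - 2 * m) / 2) (by omega) (by omega) (by omega)
          rcases Nat.mod_two_eq_zero_or_one v with hv | hv
          · rw [show 2 * m + 2 * ((v + 1 - 2 * m) / 2) = v by omega] at this
            omega
          · rw [show 2 * m + 2 * ((v + 1 - 2 * m) / 2) - 1 = v by omega] at this
            omega
        · rcases Nat.mod_two_eq_zero_or_one v with hv | hv
          · have := (ih ((2 * n - v) / 2) (by omega) (by omega) (by omega)).2
            have h5 := h.inv (2 * m + 2 * ((2 * n - v) / 2))
            rw [this, show 2 * n - 2 * ((2 * n - v) / 2) = v by omega] at h5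
            omega
          · have := (ih ((2 * n - 1 - v) / 2) (by omega) (by omega) (by omega)).1
            have h5 := h.inv (2 * m + 2 * ((2 * n - 1 - v) / 2) - 1)
            rw [this, show 2 * n - 1 - 2 * ((2 * n - 1 - v) / 2) = v by omega] at h5
            omega
      by_contra hc
      have := key (f i) h3 h4 (by omega)
      rw [h.inv] at this
      omega
    have h0 := hW (2 * m + 2 * j - 1) (by omega) (by omega)
    have h0' := hW (2 * m + 2 * j) (by omega) (by omega)
    have hasc := h.asc (i := 2 * m + 2 * j - 1) (by omega) (by omega)
    rw [show 2 * m + 2 * j - 1 + 1 = 2 * m + 2 * j by omega] at hasc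
    obtain ⟨p, hp⟩ : ∃ p, p = f (2 * m + 2 * j - 1) := ⟨_, rfl⟩
    have hfp : f p = 2 * m + 2 * j - 1 := by rw [hp, h.inv]
    rw [← hp] at h0 hasc ⊢
    have hpo : p % 2 = 1 := by
      by_contra hc
      have h1 := h.desc (i := p) (by omega) (by omega)
      have h2 := hW (p + 1) (by omega) (by omega)
      omega
    have h3 := h.valley' hmax hpo (j := 2 * n - 2 * j - 1) (by omega) (by omega) (by omega)
      (by omega)
    have h4 := hW (2 * n - 2 * j - 1) (by omega) (by omega)
    have h5 : p = 2 * n - 2 * j - 1 := h.inj (by omega)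
    omega
  · obtain ⟨h1, h2⟩ := ih (n - m - j) (by omega) (by omega) (by omega)
    have h3 := h.inv (2 * m + 2 * (n - m - j) - 1)
    have h4 := h.inv (2 * m + 2 * (n - m - j))
    rw [h1, show 2 * n - 1 - 2 * (n - m - j) = 2 * m + 2 * j - 1 by omega] at h3
    rw [h2, show 2 * n - 2 * (n - m - j) = 2 * m + 2 * j by omega] at h4
    omega

lemma even_blk {n m : ℕ} {f : ℕ → ℕ} (h : Good (2 * n) f) (hmn : m < n)
    (hl : f (2 * n - 1) = 2 * m) (hge : ∀ i, 2 * m ≤ i → i < 2 * n → 2 * m ≤ f i) :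
    ∀ i, 2 * m ≤ i → i < 2 * n → f i = blk m n i := by
  intro i h1 h2
  have h3 := even2 h hmn hl hge
  have hf : f (2 * m) = 2 * n - 1 := by rw [← hl, h.inv]
  unfold blk
  split_ifs with e1 e2 e3
  · rw [e1, hf]
  · rw [e2, hl]
  · have := (h3 ((i + 1 - 2 * m) / 2) (by omega) (by omega)).1
    rw [show 2 * m + 2 * ((i + 1 - 2 * m) / 2) - 1 = i by omega] at this
    omega
  · have := (h3 ((i - 2 * m) / 2) (by omega) (by omega)).2
    rw [show 2 * m + 2 * ((i - 2 * m) / 2) = i by omega] at this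
    omega

/-- Extend `g` on `[0, 2m)` by a block on `[2m, 2n)`. -/
def extB (m n : ℕ) (g : ℕ → ℕ) (i : ℕ) : ℕ :=
  if i < 2 * m then g i else if i < 2 * n then blk m n i else i

def cut (m : ℕ) (f : ℕ → ℕ) (i : ℕ) : ℕ := if i < 2 * m then f i else i

lemma blk_mem {m n i : ℕ} (h : m < n) (h1 : 2 * m ≤ i) (h2 : i < 2 * n) :
    2 * m ≤ blk m n i ∧ blk m n i < 2 * n := by
  unfold blk; split_ifs <;> omega
lemma blk_inv {m n i : ℕ} (h : m < n) (h1 : 2 * m ≤ i) (h2 : i < 2 * n) :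
    blk m n (blk m n i) = i := by
  unfold blk; split_ifs <;> omega
lemma blk_alt {m n i : ℕ} (h : m < n) (h1 : 2 * m ≤ i) (h2 : i + 1 < 2 * n) :
    blk m n (i + 1) < blk m n i ↔ i % 2 = 0 := by
  unfold blk; split_ifs <;> omega
lemma blk_asc {m n i j : ℕ} (h : m < n) (h1 : 2 * m ≤ i) (hij : i < j) (h2 : j < 2 * n)
    (h3 : blk m n i < blk m n j) : j = i + 1 := by
  revert h3
  unfold blk; split_ifs <;> omega

lemma good_extB {m n : ℕ} {g : ℕ → ℕ} (h : m < n) (hg : Good (2 * m) g) :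
    Good (2 * n) (extB m n g) := by
  have hl : ∀ i, i < 2 * m → extB m n g i = g i ∧ g i < 2 * m := by
    intro i hi; exact ⟨by simp [extB, hi], hg.lt hi⟩
  have hm : ∀ i, 2 * m ≤ i → i < 2 * n → extB m n g i = blk m n i := by
    intro i h1 h2; simp [extB, h2, not_lt.mpr h1]
  have hh : ∀ i, 2 * n ≤ i → extB m n g i = i := by
    intro i h1
    have h2 : ¬ i < 2 * n := by omega
    have h3 : ¬ i < 2 * m := by omega
    simp [extB, h2, h3]
  refine ⟨?_, hh, ?_, ?_⟩
  · intro i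
    by_cases h1 : i < 2 * m
    · obtain ⟨e, l⟩ := hl i h1
      rw [e, (hl _ l).1, hg.inv]
    · by_cases h2 : i < 2 * n
      · have := blk_mem h (not_lt.mp h1) h2
        rw [hm i (by omega) h2, hm _ this.1 this.2, blk_inv h (by omega) h2]
      · rw [hh i (by omega), hh i (by omega)]
  · intro i hi
    by_cases h1 : i + 1 < 2 * m
    · rw [(hl i (by omega)).1, (hl _ h1).1]
      exact hg.2.2.1 i h1
    · by_cases h2 : i < 2 * m
      · have h3 := hl i h2
        have h4 := hm (i + 1) (by omega) hi
        have h5 := blk_mem (i := i + 1) h (by omega) hi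
        omega
      · rw [hm i (by omega) (by omega), hm _ (by omega) hi]
        exact blk_alt h (by omega) hi
  · intro i j k l hij hjk hkl h1 h2 h3
    have hln : l < 2 * n := by
      by_contra hc
      have h4 := hh l (by omega)
      by_cases h5 : i < 2 * m
      · have := hl i h5
        omega
      · by_cases h6 : i < 2 * n
        · have := hm i (by omega) h6
          have := blk_mem h (not_lt.mp h5) h6
          omega
        · have := hh i (by omega)
          omega
    by_cases hlm : l < 2 * m
    · rw [(hl i (by omega)).1, (hl l (by omega)).1] at h1
      rw [(hl i (by omega)).1, (hl k (by omega)).1] at h2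
      rw [(hl k (by omega)).1, (hl j (by omega)).1] at h3
      exact hg.a2431 hij hjk hkl h1 h2 h3
    · have h4 := blk_mem (i := l) h (by omega) hln
      have h5 := hm l (by omega) hln
      have h6 : 2 * m ≤ i := by
        by_contra hc
        have := hl i (by omega)
        omega
      rw [hm i (by omega) (by omega), hm k (by omega) (by omega)] at h2
      rw [hm k (by omega) (by omega), hm j (by omega) (by omega)] at h3
      have := blk_asc h h6 (by omega) (by omega) h2
      have := blk_asc h h6 hij (by omega) (h2.trans h3)
      omega

lemma good_cut {m n : ℕ} {f : ℕ → ℕ} (hmn : m < n) (hf : Good (2 * n) f)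
    (h : ∀ i, i < 2 * m → f i < 2 * m) : Good (2 * m) (cut m f) := by
  have hl : ∀ i, i < 2 * m → cut m f i = f i := by
    intro i hi; simp [cut, hi]
  have hh : ∀ i, 2 * m ≤ i → cut m f i = i := by
    intro i h1; simp [cut, not_lt.mpr h1]
  refine ⟨?_, hh, ?_, ?_⟩
  · intro i
    by_cases h1 : i < 2 * m
    · rw [hl i h1, hl _ (h i h1), hf.inv]
    · rw [hh i (by omega), hh i (by omega)]
  · intro i hi
    rw [hl i (by omega), hl _ hi]
    exact hf.2.2.1 i (by omega)
  · intro i j k l hij hjk hkl h1 h2 h3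
    have hln : l < 2 * m := by
      by_contra hc
      have h4 := hh l (by omega)
      by_cases h5 : i < 2 * m
      · have := hl i h5
        have := h i h5
        omega
      · have := hh i (by omega)
        omega
    rw [hl i (by omega), hl l (by omega)] at h1
    rw [hl i (by omega), hl k (by omega)] at h2
    rw [hl k (by omega), hl j (by omega)] at h3
    exact hf.a2431 hij hjk hkl h1 h2 h3

/-- Basic structure in the odd case when the last point is not fixed. -/
lemma odd_basic {n : ℕ} {f : ℕ → ℕ} (h : Good (2 * n + 1) f) (hne : f (2 * n) ≠ 2 * n) :
    ∃ M c, f (2 * n) = M ∧ f M = 2 * n ∧ f (2 * n - 1) = c ∧ f c = 2 * n - 1 ∧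
      M % 2 = 0 ∧ c % 2 = 0 ∧ c < M ∧ M < 2 * n ∧ f (M - 1) < M ∧
      (∀ i, M < i → i < 2 * n → c ≤ f i ∧ f i < M) ∧ (M + 1 < 2 * n - 1 → c < f (M + 1)) := by
  obtain ⟨M, hM⟩ : ∃ M, f (2 * n) = M := ⟨_, rfl⟩
  obtain ⟨c, hc⟩ : ∃ c, f (2 * n - 1) = c := ⟨_, rfl⟩
  have hfM : f M = 2 * n := by rw [← hM, h.inv]
  have hfc : f c = 2 * n - 1 := by rw [← hc, h.inv]
  have hMl : M < 2 * n := by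
    have := h.lt (i := 2 * n) (by omega)
    omega
  have hcM : c < M := by
    have := h.asc (i := 2 * n - 1) (by omega) (by omega)
    rw [show 2 * n - 1 + 1 = 2 * n by omega] at this
    omega
  have hMe : M % 2 = 0 := by
    by_contra hc
    have h1 := h.desc (i := M - 1) (by omega) (by omega)
    rw [show M - 1 + 1 = M by omega] at h1
    have := h.lt (i := M - 1) (by omega)
    omega
  have hce : c % 2 = 0 := by
    by_contra hc
    have h1 := h.desc (i := c - 1) (by omega) (by omega)
    rw [show c - 1 + 1 = c by omega] at h1
    have := h.lt (i := c - 1) (by omega)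
    have : c - 1 = M := h.inj (by omega)
    omega
  have hmax : ∀ i, M < i → i < 2 * n + 1 → f i < f M := by
    intro i h1 h2
    have h3 := h.lt h2
    have h4 : f i ≠ f M := fun e => by have := h.inj e; omega
    omega
  have hneM : ∀ i, i ≠ 2 * n → f i ≠ M := by
    intro i hi e
    exact hi (h.inj (by omega))
  have hodd : ∀ i, i % 2 = 1 → M < i → i < 2 * n → c ≤ f i := by
    intro i h1 h2 h3
    have := h.valley' hmax h1 (j := 2 * n - 1) (by omega) h2 (by omega) (by omega)
    omega
  have hge : ∀ i, M < i → i < 2 * n → c ≤ f i := by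
    intro i h1 h2
    by_cases hi : i % 2 = 1
    · exact hodd i hi h1 h2
    · have h4 := hodd (i - 1) (by omega) (by omega) (by omega)
      have h5 := h.asc (i := i - 1) (by omega) (by omega)
      rw [show i - 1 + 1 = i by omega] at h5
      omega
  have hev : ∀ i, i % 2 = 1 → M < i → i + 1 < 2 * n → f i < M → f (i + 1) < M := by
    intro i h1 h2 h3 h4
    by_contra h5
    have := hneM (i + 1) (by omega)
    exact h.a4132 (i := M) (j := i) (k := i + 1) (l := 2 * n) h2 (by omega) h3 (by omega)
      (by omega) (hmax _ (by omega) (by omega))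
  have hA : f (M - 1) < M := by
    by_contra hcon
    obtain ⟨d, hd⟩ : ∃ d, f (M - 1) = d := ⟨_, rfl⟩
    have hfd : f d = M - 1 := by rw [← hd, h.inv]
    have hdM := hneM (M - 1) (by omega)
    have hdl := h.lt (i := M - 1) (by omega)
    have hd1 : d ≠ 2 * n := fun e => by
      have : M - 1 = M := h.inj (by omega)
      omega
    have hd2 : d ≠ 2 * n - 1 := fun e => by
      have : M - 1 = c := h.inj (by omega)
      omega
    by_cases hdo : d % 2 = 1
    · have h1 := h.asc (i := d) (by omega) hdo
      have h2 := hev d hdo (by omega) (by omega) (by omega)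
      omega
    · obtain ⟨y, hy⟩ : ∃ y, f (d - 1) = y := ⟨_, rfl⟩
      have hfy : f y = d - 1 := by rw [← hy, h.inv]
      have h1 := h.asc (i := d - 1) (by omega) (by omega)
      rw [show d - 1 + 1 = d by omega] at h1
      have hcy := hodd (d - 1) (by omega) (by omega) (by omega)
      have hdne : ∀ i, i ≠ M - 1 → f i ≠ d := by
        intro i hi e
        exact hi (h.inj (by omega))
      by_cases hyo : y % 2 = 1
      · have h2 := h.asc (i := y) (by omega) hyo
        have := hdne (y + 1) (by omega)
        exact h.a2431 (i := y) (j := y + 1) (k := M - 1) (l := 2 * n - 1) (by omega) (by omega)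
          (by omega) (by omega) (by omega) (by omega)
      · have h2 := h.desc (i := y) (by omega) (by omega)
        have h6 := h.desc (i := M - 2) (by omega) (by omega)
        rw [show M - 2 + 1 = M - 1 by omega] at h6
        have hy1 : y + 1 ≠ M - 1 := fun e => by
          rw [e] at h2
          omega
        by_cases h7 : c < f (y + 1)
        · exact h.a2431 (i := y + 1) (j := M - 2) (k := M - 1) (l := 2 * n - 1) (by omega)
            (by omega) (by omega) (by omega) (by omega) (by omega)
        · exact h.a4132 (i := c) (j := y + 1) (k := M - 1) (l := 2 * n) (by omega) (by omega)
            (by omega) (by omega) (by omega) (by omega)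
  have ha : f (M + 1) < M := by
    by_contra hcon
    have h1 := hneM (M + 1) (by omega)
    have h2 : f (M + 1) ≠ 2 * n - 1 := fun e => by
      have : M + 1 = c := h.inj (by omega)
      omega
    have h3 := hmax (M + 1) (by omega) (by omega)
    exact h.a4132 (i := c) (j := M - 1) (k := M + 1) (l := 2 * n) (by omega) (by omega)
            (by omega) (by omega) (by omega) (by omega)
  have hB1 : ∀ i, i % 2 = 1 → M < i → i < 2 * n → f i < M := by
    intro i h1 h2 h3
    have := h.valley' hmax (i := M + 1) (by omega) (j := i) h1 (by omega) (by omega) (by omega)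
    omega
  refine ⟨M, c, hM, hfM, hc, hfc, hMe, hce, hcM, hMl, hA, ?_, ?_⟩
  · intro i h1 h2
    refine ⟨hge i h1 h2, ?_⟩
    by_cases hi : i % 2 = 1
    · exact hB1 i hi h1 h2
    · have h4 := hev (i - 1) (by omega) (by omega) (by omega) (hB1 _ (by omega) (by omega) (by omega))
      rw [show i - 1 + 1 = i by omega] at h4
      omega
  · intro h1
    have h2 := hge (M + 1) (by omega) (by omega)
    have h3 : f (M + 1) ≠ c := fun e => by
      have : M + 1 = 2 * n - 1 := h.inj (by omega)
      omega
    omega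

/-- Case (iia): the crossing chain can be shortened. -/
lemma odd_cross {n : ℕ} {f : ℕ → ℕ} (h : Good (2 * n + 1) f) (hne : f (2 * n) ≠ 2 * n)
    {x : ℕ} (hx : x < f (2 * n - 1)) (hX : f (2 * n - 1) < f x) :
    f (2 * n) = 2 * n - 2 ∧ f (2 * n - 3) < f (2 * n - 1) ∧ f (2 * n - 1) < 2 * n - 2 := by
  obtain ⟨M, c, hM, hfM, hc, hfc, hMe, hce, hcM, hMl, hA, hB, hC⟩ := odd_basic h hne
  rw [hc] at hx hX ⊢
  rw [hM]
  have hXM : f x < M := by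
    by_contra hcon
    have h1 : f x ≠ M := fun e => by
      have : x = 2 * n := h.inj (by omega)
      omega
    have h2 : f x ≠ 2 * n := fun e => by
      have : x = M := h.inj (by omega)
      omega
    have h3 := h.lt (i := x) (by omega)
    have h4 := hB (f x) (by omega) (by omega)
    rw [h.inv] at h4
    omega
  have hM2 : M = 2 * n - 2 := by
    by_contra hcon
    have h1 := hC (by omega)
    have h2 := hB (M + 1) (by omega) (by omega)
    have h3 := h.inv (M + 1)
    exact h.a2431 (i := x) (j := c) (k := f (M + 1)) (l := 2 * n - 1) hx h1
      (by omega) (by omega) (by omega) (by omega)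
  refine ⟨hM2, ?_, by omega⟩
  rw [show 2 * n - 3 = M - 1 by omega]
  by_contra hcon
  obtain ⟨d, hd⟩ : ∃ d, f (M - 1) = d := ⟨_, rfl⟩
  have hfd : f d = M - 1 := by rw [← hd, h.inv]
  have hdc : d ≠ c := fun e => by
    have : M - 1 = 2 * n - 1 := h.inj (by omega)
    omega
  have hXne : f x ≠ M - 1 := fun e => by
    have : x = d := h.inj (by omega)
    omega
  by_cases hdM : d = M - 1
  · have h6 := h.desc (i := M - 2) (by omega) (by omega)
    rw [show M - 2 + 1 = M - 1 by omega] at h6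
    have h7 := h.lt (i := M - 2) (by omega)
    have h1 : f (M - 2) ≠ M := fun e => by
      have : M - 2 = 2 * n := h.inj (by omega)
      omega
    have h2 : f (M - 2) ≠ 2 * n := fun e => by
      have : M - 2 = M := h.inj (by omega)
      omega
    have : M - 2 = c := h.inj (by omega)
    omega
  · exact h.a2431 (i := x) (j := c) (k := d) (l := 2 * n - 1) hx (by omega)
      (by omega) (by omega) (by omega) (by omega)

/-- Shortening map. -/
def shr (n : ℕ) (f : ℕ → ℕ) (i : ℕ) : ℕ :=
  if i = f (2 * n - 1) then 2 * n - 2 else if i = 2 * n - 2 then f (2 * n - 1)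
  else if 2 * n - 1 ≤ i then i else f i

/-- Lengthening map. -/
def lng (n : ℕ) (g : ℕ → ℕ) (i : ℕ) : ℕ :=
  if i = g (2 * n - 2) then 2 * n - 1 else if i = 2 * n - 1 then g (2 * n - 2)
  else if i = 2 * n - 2 then 2 * n else if i = 2 * n then 2 * n - 2 else g i

lemma good_shr {n : ℕ} {f : ℕ → ℕ} (h : Good (2 * n + 1) f)
    (h1 : f (2 * n) = 2 * n - 2) (h2 : f (2 * n - 3) < f (2 * n - 1))
    (h3 : f (2 * n - 1) < 2 * n - 2) (hce : f (2 * n - 1) % 2 = 0) : Good (2 * n - 1) (shr n f) := by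
  obtain ⟨c, hc⟩ : ∃ c, f (2 * n - 1) = c := ⟨_, rfl⟩
  have hfc : f c = 2 * n - 1 := by rw [← hc, h.inv]
  have hfM : f (2 * n - 2) = 2 * n := by rw [← h1, h.inv]
  rw [hc] at h2 h3 hce
  have e1 : shr n f c = 2 * n - 2 := by simp [shr, hc]
  have e2 : shr n f (2 * n - 2) = c := by
    have : 2 * n - 2 ≠ c := by omega
    simp [shr, hc, this]
  have e3 : ∀ i, 2 * n - 1 ≤ i → shr n f i = i := by
    intro i hi
    have : i ≠ c := by omega
    have : i ≠ 2 * n - 2 := by omega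
    simp [shr, hc, *]
  have e4 : ∀ i, i < 2 * n - 2 → i ≠ c → shr n f i = f i ∧ f i < 2 * n - 2 ∧ f i ≠ c := by
    intro i h1' h2'
    have a1 : i ≠ 2 * n - 2 := by omega
    have a2 : ¬ 2 * n - 1 ≤ i := by omega
    refine ⟨by simp [shr, hc, a1, a2, h2'], ?_, ?_⟩
    · have b1 := h.lt (i := i) (by omega)
      have b2 : f i ≠ 2 * n - 2 := fun e => by
        have : i = 2 * n := h.inj (by omega)
        omega
      have b3 : f i ≠ 2 * n - 1 := fun e => by
        have : i = c := h.inj (by omega)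
        omega
      have b4 : f i ≠ 2 * n := fun e => by
        have : i = 2 * n - 2 := h.inj (by omega)
        omega
      omega
    · intro e
      have : i = 2 * n - 1 := h.inj (by omega)
      omega
  have cas : ∀ i, i = c ∨ i = 2 * n - 2 ∨ 2 * n - 1 ≤ i ∨ (i < 2 * n - 2 ∧ i ≠ c) := by
    intro i; omega
  refine ⟨?_, e3, ?_, ?_⟩
  · intro i
    rcases cas i with rfl | rfl | h5 | ⟨h5, h6⟩
    · rw [e1, e2]
    · rw [e2, e1]
    · rw [e3 i h5, e3 i h5]
    · obtain ⟨a, b, b'⟩ := e4 i h5 h6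
      rw [a, (e4 _ b b').1, h.inv]
  · intro i hi
    have ha := h.2.2.1 i (by omega)
    by_cases q1 : i = c
    · have := e4 (i + 1) (by grind) (by omega)
      grind
    by_cases q2 : i + 1 = c
    · have := e4 i (by omega) (by omega)
      grind
    have := e4 i (by omega) (by omega)
    by_cases q3 : i + 1 = 2 * n - 2
    · rw [q3, e2, this.1]
      rw [show 2 * n - 3 = i by omega] at h2
      omega
    have := e4 (i + 1) (by omega) q2
    omega
  · intro i j k l hij hjk hkl p1 p2 p3
    have hv : ∀ i, i < 2 * n - 1 → shr n f i < 2 * n - 1 := by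
      intro i hi
      rcases cas i with rfl | rfl | h5 | ⟨h5, h6⟩
      · omega
      · omega
      · omega
      · have := e4 i h5 h6
        omega
    have hln : l < 2 * n - 1 := by
      by_contra hcon
      have h4 := e3 l (by omega)
      by_cases h5 : i < 2 * n - 1
      · have := hv i h5
        omega
      · have := e3 i (by omega)
        omega
    -- relation between values
    have rel : ∀ i, i < 2 * n - 2 → f i = if shr n f i = 2 * n - 2 then 2 * n - 1 else shr n f i := by
      intro i hi
      rcases cas i with rfl | rfl | h5 | ⟨h5, h6⟩
      · simp [e1, hfc]
      · omega
      · omega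
      · have := e4 i h5 h6
        rw [if_neg (by omega)]
        omega
    have ri := rel i (by omega)
    have rj := rel j (by omega)
    have rk := rel k (by omega)
    have vj := hv j (by omega)
    by_cases hl2 : l = 2 * n - 2
    · rw [hl2, e2] at p1
      split_ifs at ri rj rk <;>
      first
      | omega
      | exact h.a2431 (i := i) (j := j) (k := k) (l := 2 * n - 1) hij hjk (by omega) (by omega) (by omega) (by omega)
    · have rl := rel l (by omega)
      split_ifs at ri rj rk rl <;>
      first
      | omega
      | exact h.a2431 hij hjk hkl (by omega) (by omega) (by omega)

lemma lng_shr {n : ℕ} {f : ℕ → ℕ} (h : Good (2 * n + 1) f)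
    (h1 : f (2 * n) = 2 * n - 2) (h3 : f (2 * n - 1) < 2 * n - 2) : lng n (shr n f) = f := by
  obtain ⟨c, hc⟩ : ∃ c, f (2 * n - 1) = c := ⟨_, rfl⟩
  have hfc : f c = 2 * n - 1 := by rw [← hc, h.inv]
  have hfM : f (2 * n - 2) = 2 * n := by rw [← h1, h.inv]
  rw [hc] at h3
  have e2 : shr n f (2 * n - 2) = c := by
    have : 2 * n - 2 ≠ c := by omega
    simp [shr, hc, this]
  funext i
  unfold lng
  rw [e2]
  split_ifs with q1 q2 q3 q4
  · rw [q1, hfc]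
  · rw [q2, hc]
  · rw [q3, hfM]
  · rw [q4, h1]
  · unfold shr
    rw [hc, if_neg q1, if_neg q3]
    split_ifs with q5
    · rw [h.out (by omega)]
    · rfl

lemma good_lng {n : ℕ} {g : ℕ → ℕ} (h : Good (2 * n - 1) g) (hn : 1 ≤ n)
    (hne : g (2 * n - 2) ≠ 2 * n - 2) : Good (2 * n + 1) (lng n g) := by
  obtain ⟨c, hc⟩ : ∃ c, g (2 * n - 2) = c := ⟨_, rfl⟩
  have hgc : g c = 2 * n - 2 := by rw [← hc, h.inv]
  have hcl : c < 2 * n - 2 := by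
    have := h.lt (i := 2 * n - 2) (by omega)
    omega
  have e1 : lng n g c = 2 * n - 1 := by simp [lng, hc]
  have e2 : lng n g (2 * n - 1) = c := by
    have : 2 * n - 1 ≠ c := by omega
    simp [lng, hc, this]
  have e3 : lng n g (2 * n - 2) = 2 * n := by
    have : 2 * n - 2 ≠ c := by omega
    have : 2 * n - 2 ≠ 2 * n - 1 := by omega
    simp [lng, hc, *]
  have e4 : lng n g (2 * n) = 2 * n - 2 := by
    have : 2 * n ≠ c := by omega
    have : 2 * n ≠ 2 * n - 1 := by omega
    have : 2 * n ≠ 2 * n - 2 := by omega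
    simp [lng, hc, *]
  have e5 : ∀ i, 2 * n < i → lng n g i = i := by
    intro i hi
    have : i ≠ c := by omega
    have : i ≠ 2 * n - 1 := by omega
    have : i ≠ 2 * n - 2 := by omega
    have : i ≠ 2 * n := by omega
    have : g i = i := h.out (by omega)
    simp [lng, hc, *]
  have e6 : ∀ i, i < 2 * n - 2 → i ≠ c → lng n g i = g i ∧ g i < 2 * n - 2 ∧ g i ≠ c := by
    intro i h1 h2
    have a1 : i ≠ 2 * n - 1 := by omega
    have a2 : i ≠ 2 * n - 2 := by omega
    have a3 : i ≠ 2 * n := by omega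
    refine ⟨by simp [lng, hc, *], ?_, ?_⟩
    · have b1 := h.lt (i := i) (by omega)
      have b2 : g i ≠ 2 * n - 2 := fun e => by
        have : i = c := h.inj (by omega)
        omega
      omega
    · intro e
      have : i = 2 * n - 2 := h.inj (by omega)
      omega
  have cas : ∀ i, i = c ∨ i = 2 * n - 1 ∨ i = 2 * n - 2 ∨ i = 2 * n ∨ 2 * n < i ∨
      (i < 2 * n - 2 ∧ i ≠ c) := by
    intro i; omega
  refine ⟨?_, fun i hi => e5 i (by omega), ?_, ?_⟩
  · intro i
    rcases cas i with rfl | rfl | rfl | rfl | h5 | ⟨h5, h6⟩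
    · rw [e1, e2]
    · rw [e2, e1]
    · rw [e3, e4]
    · rw [e4, e3]
    · rw [e5 i h5, e5 i h5]
    · obtain ⟨a, b, b'⟩ := e6 i h5 h6
      rw [a, (e6 _ b b').1, h.inv]
  · intro i hi
    by_cases k1 : i = 2 * n - 1
    · rw [show i + 1 = 2 * n by omega, k1, e2, e4]; omega
    by_cases k2 : i = 2 * n - 2
    · rw [show i + 1 = 2 * n - 1 by omega, k2, e2, e3]; omega
    have ha := h.2.2.1 i (by omega)
    by_cases k3 : i = 2 * n - 3
    · rw [show i + 1 = 2 * n - 2 by omega] at ha ⊢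
      rw [e3]
      by_cases k4 : i = c
      · rw [k4, e1]; omega
      · have := e6 i (by omega) k4
        omega
    by_cases q1 : i = c
    · have := e6 (i + 1) (by grind) (by omega)
      grind
    by_cases q2 : i + 1 = c
    · have := e6 i (by omega) (by omega)
      grind
    have := e6 i (by omega) (by omega)
    have := e6 (i + 1) (by omega) q2
    omega
  · intro i j k l hij hjk hkl p1 p2 p3
    have hv : ∀ i, i ≤ 2 * n → lng n g i ≤ 2 * n := by
      intro i hi
      rcases cas i with rfl | rfl | rfl | rfl | h5 | ⟨h5, h6⟩
      · omega
      · omega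
      · omega
      · omega
      · omega
      · have := e6 i h5 h6
        omega
    have hv1 : ∀ i, i < 2 * n - 2 → lng n g i ≤ 2 * n - 1 ∧ lng n g i ≠ 2 * n - 2 ∧
        (lng n g i = 2 * n - 1 → i = c) := by
      intro i hi
      rcases cas i with rfl | rfl | rfl | rfl | h5 | ⟨h5, h6⟩
      · omega
      · omega
      · omega
      · omega
      · omega
      · have := e6 i h5 h6
        omega
    have hln : l ≤ 2 * n := by
      by_contra hcon
      have h4 := e5 l (by omega)
      by_cases h5 : i ≤ 2 * n
      · have := hv i h5
        omega
      · have := e5 i (by omega)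
        omega
    have rel : ∀ i, i < 2 * n - 2 → g i = if lng n g i = 2 * n - 1 then 2 * n - 2 else lng n g i := by
      intro i hi
      rcases cas i with rfl | rfl | rfl | rfl | h5 | ⟨h5, h6⟩
      · simp [e1, hgc]
      · omega
      · omega
      · omega
      · omega
      · have := e6 i h5 h6
        rw [if_neg (by omega)]
        omega
    by_cases l1 : l = 2 * n
    · rw [l1, e4] at p1
      have hi := hv1 i (by omega)
      have hj := hv j (by omega)
      have hk : lng n g k = 2 * n := by
        have := hv k (by omega)
        omega
      omega
    have hk : k ≠ 2 * n - 2 := fun e => by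
      rw [e, e3] at p3
      have := hv j (by omega)
      omega
    have vk := hv1 k (by omega)
    have ri := rel i (by omega)
    have rk := rel k (by omega)
    have rj := rel j (by omega)
    have vj := hv1 j (by omega)
    have l2 : l ≠ 2 * n - 2 := fun e => by
      rw [e, e3] at p1
      have := hv1 i (by omega)
      omega
    by_cases l3 : l = 2 * n - 1
    · rw [l3, e2] at p1
      split_ifs at ri rj rk <;>
      first
      | omega
      | exact h.a2431 (i := i) (j := j) (k := k) (l := 2 * n - 2) hij hjk (by omega) (by omega) (by omega) (by omega)
    · have rl := rel l (by omega)
      split_ifs at ri rj rk rl <;>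
      first
      | omega
      | exact h.a2431 hij hjk hkl (by omega) (by omega) (by omega)

lemma lng_inj {n : ℕ} {g g' : ℕ → ℕ} (h : Good (2 * n - 1) g) (h' : Good (2 * n - 1) g')
    (hn : 1 ≤ n) (hne : g (2 * n - 2) ≠ 2 * n - 2) (hne' : g' (2 * n - 2) ≠ 2 * n - 2)
    (e : lng n g = lng n g') : g = g' := by
  have key : ∀ g : ℕ → ℕ, Good (2 * n - 1) g → g (2 * n - 2) ≠ 2 * n - 2 →
      g = shr n (lng n g) := by
    intro g h hne
    obtain ⟨c, hc⟩ : ∃ c, g (2 * n - 2) = c := ⟨_, rfl⟩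
    have hgc : g c = 2 * n - 2 := by rw [← hc, h.inv]
    have hcl : c < 2 * n - 2 := by
      have := h.lt (i := 2 * n - 2) (by omega)
      omega
    have e2 : lng n g (2 * n - 1) = c := by
      have : 2 * n - 1 ≠ c := by omega
      simp [lng, hc, this]
    funext i
    unfold shr
    rw [e2]
    split_ifs with q1 q2 q3
    · rw [q1, hgc]
    · rw [q2, hc]
    · exact h.out q3
    · unfold lng
      rw [hc, if_neg q1, if_neg (by omega), if_neg q2, if_neg (by omega)]
  rw [key g h hne, key g' h' hne', e]

/-- Contract the last arc to a fixed point. -/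
def con (n : ℕ) (f : ℕ → ℕ) (i : ℕ) : ℕ :=
  if i = f (2 * n) then i else if i = 2 * n then 2 * n else f i

/-- Expand the central fixed point of the last block to an arc. -/
def expd (n : ℕ) (g : ℕ → ℕ) (i : ℕ) : ℕ :=
  if i = g (2 * n - 1) / 2 + n then 2 * n else if i = 2 * n then g (2 * n - 1) / 2 + n else g i

lemma good_con {n : ℕ} {f : ℕ → ℕ} (h : Good (2 * n + 1) f) (hne : f (2 * n) ≠ 2 * n)
    (hx : ∀ x, x < f (2 * n - 1) → f x ≤ f (2 * n - 1)) :
    Good (2 * n) (con n f) ∧ con n f (2 * n - 1) = f (2 * n - 1) ∧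
      (n - f (2 * n - 1) / 2) % 2 = 0 ∧ expd n (con n f) = f := by
  obtain ⟨M, c, hM, hfM, hc, hfc, hMe, hce, hcM, hMl, hA, hB, hC⟩ := odd_basic h hne
  rw [hc] at hx ⊢
  have e1 : con n f M = M := by simp [con, hM]
  have e1' : ∀ i, i = M → con n f i = M := by
    rintro i rfl
    exact e1
  have e2 : ∀ i, 2 * n ≤ i → con n f i = i := by
    intro i hi
    unfold con
    split_ifs with a b
    · rfl
    · omega
    · exact h.out (by omega)
  have e3 : ∀ i, i < 2 * n → i ≠ M → con n f i = f i ∧ f i < 2 * n ∧ f i ≠ M := by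
    intro i h1 h2
    have a1 : i ≠ 2 * n := by omega
    refine ⟨by simp [con, hM, h2, a1], ?_, ?_⟩
    · have b1 := h.lt (i := i) (by omega)
      have b2 : f i ≠ 2 * n := fun e => h2 (h.inj (by omega))
      omega
    · exact fun e => a1 (h.inj (by omega))
  have hgood : Good (2 * n) (con n f) := by
    refine ⟨?_, e2, ?_, ?_⟩
    · intro i
      by_cases h1 : i = M
      · rw [h1, e1, e1]
      by_cases h2 : 2 * n ≤ i
      · rw [e2 i h2, e2 i h2]
      obtain ⟨a, b, b'⟩ := e3 i (by omega) h1
      rw [a, (e3 _ b b').1, h.inv]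
    · intro i hi
      have ha := h.2.2.1 i (by omega)
      by_cases h1 : i = M
      · have := e3 (i + 1) hi (by omega)
        have := hB (i + 1) (by omega) hi
        have := e1' i h1
        omega
      have := e3 i (by omega) h1
      by_cases h2 : i + 1 = M
      · rw [show M - 1 = i by omega] at hA
        have := e1' _ h2
        omega
      have := e3 (i + 1) hi h2
      omega
    · intro i j k l hij hjk hkl p1 p2 p3
      have hln : l < 2 * n := by
        by_contra hcon
        have h4 := e2 l (by omega)
        by_cases h5 : i < 2 * n
        · by_cases h6 : i = M
          · have := e1' i h6
            omega
          · have := e3 i h5 h6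
            omega
        · have := e2 i (by omega)
          omega
      by_cases i1 : i = M
      · have := e3 k (by omega) (by omega)
        have := hB k (by omega) (by omega)
        have := e1' i i1
        omega
      have hi := e3 i (by omega) i1
      by_cases j1 : j = M
      · have hk := e3 k (by omega) (by omega)
        have hl := e3 l (by omega) (by omega)
        exact h.a2431 hij hjk hkl (by omega) (by omega) (by rw [j1, hfM]; omega)
      have hj := e3 j (by omega) j1
      by_cases k1 : k = M
      · have hl := e3 l (by omega) (by omega)
        have hl' := hB l (by omega) (by omega)
        have hkM := e1' k k1
        have hic : c ≤ i := by
          by_contra hcon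
          have := hx i (by omega)
          omega
        have hic' : i ≠ c := fun e => by
          have : f i = 2 * n - 1 := by rw [e, hfc]
          omega
        have hj2 : f j ≠ 2 * n - 1 := fun e => by
          have : j = c := h.inj (by omega)
          omega
        exact h.a4132 (i := c) (j := i) (k := j) (l := 2 * n) (by omega) hij (by omega) (by omega)
          (by omega) (by omega)
      have hk := e3 k (by omega) k1
      by_cases l1 : l = M
      · have := e1' l l1
        exact h.a2431 (i := i) (j := j) (k := k) (l := 2 * n) hij hjk (by omega) (by omega)
          (by omega) (by omega)
      have hl := e3 l (by omega) l1
      exact h.a2431 hij hjk hkl (by omega) (by omega) (by omega)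
  have hn1 : M ≠ 2 * n - 1 := by omega
  have hcc : con n f (2 * n - 1) = c := by
    rw [(e3 (2 * n - 1) (by omega) (by omega)).1, hc]
  obtain ⟨m, hm1, hm2, hm3, hm4⟩ := hgood.even1 (by omega)
  have hb := even_blk hgood hm1 hm2 hm4 M (by omega) hMl
  have hMmn : M = m + n := by
    unfold blk at hb
    rw [if_neg (by omega), if_neg hn1, if_neg (by omega)] at hb
    omega
  refine ⟨hgood, hcc, by omega, ?_⟩
  funext i
  unfold expd
  rw [hcc, show c / 2 + n = M by omega]
  split_ifs with q1 q2
  · rw [q1, hfM]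
  · rw [q2, hM]
  · unfold con
    rw [hM, if_neg q1, if_neg q2]

lemma expd_spec {n : ℕ} {g : ℕ → ℕ} (h : Good (2 * n) g) (hn : 1 ≤ n)
    (hpar : (n - g (2 * n - 1) / 2) % 2 = 0) :
    Good (2 * n + 1) (expd n g) ∧ expd n g (2 * n) ≠ 2 * n ∧ con n (expd n g) = g ∧
    ∀ x, x < expd n g (2 * n - 1) → expd n g x < expd n g (2 * n - 1) := by
  obtain ⟨m, hm1, hm2, hm3, hm4⟩ := h.even1 hn
  have hblk := even_blk h hm1 hm2 hm4
  rw [hm2, show 2 * m / 2 = m by omega] at hpar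
  obtain ⟨M, hM⟩ : ∃ M, M = m + n := ⟨_, rfl⟩
  have hMe : M % 2 = 0 := by omega
  have hgM : g M = M := by
    rw [hblk M (by omega) (by omega)]
    unfold blk
    rw [if_neg (by omega), if_neg (by omega), if_neg (by omega)]
    omega
  have hafter : ∀ i, M < i → i < 2 * n → g i < M := by
    intro i h1 h2
    rw [hblk i (by omega) (by omega)]
    unfold blk
    split_ifs <;> omega
  have hdef : ∀ i, expd n g i = if i = M then 2 * n else if i = 2 * n then M else g i := by
    intro i
    unfold expd
    rw [hm2, show 2 * m / 2 + n = M by omega]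
  have e1 : expd n g M = 2 * n := by simp [hdef]
  have e1' : ∀ i, i = M → expd n g i = 2 * n := by
    rintro i rfl
    exact e1
  have e2 : expd n g (2 * n) = M := by
    rw [hdef, if_neg (by omega), if_pos rfl]
  have e3 : ∀ i, i ≠ M → i ≠ 2 * n → expd n g i = g i := by
    intro i h1 h2
    rw [hdef, if_neg h1, if_neg h2]
  have e4 : ∀ i, i < 2 * n → i ≠ M → g i < 2 * n ∧ g i ≠ M := by
    intro i h1 h2
    exact ⟨h.lt h1, fun e => h2 (h.inj (by omega))⟩
  have el : expd n g (2 * n - 1) = 2 * m := by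
    rw [e3 _ (by omega) (by omega), hm2]
  refine ⟨⟨?_, ?_, ?_, ?_⟩, by omega, ?_, ?_⟩
  · intro i
    by_cases h1 : i = M
    · rw [h1, e1, e2]
    by_cases h2 : i = 2 * n
    · rw [h2, e2, e1]
    rw [e3 i h1 h2]
    have h3 : g i ≠ M := fun e => h1 (h.inj (by omega))
    have h4 : g i ≠ 2 * n := fun e => h2 (h.inj (by rw [e, h.out le_rfl]))
    rw [e3 _ h3 h4, h.inv]
  · intro i hi
    rw [e3 i (by omega) (by omega), h.out (by omega)]
  · intro i hi
    by_cases h1 : i = 2 * n - 1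
    · rw [show i + 1 = 2 * n by omega, h1, e2, el]
      omega
    have ha := h.2.2.1 i (by omega)
    by_cases h2 : i = M
    · have := e3 (i + 1) (by omega) (by omega)
      have := hafter (i + 1) (by omega) (by omega)
      have := e1' i h2
      omega
    have h3 := e3 i h2 (by omega)
    have h3' := e4 i (by omega) h2
    by_cases h4 : i + 1 = M
    · have := e1' _ h4
      omega
    have h5 := e3 (i + 1) h4 (by omega)
    omega
  · intro i j k l hij hjk hkl p1 p2 p3
    have hv : ∀ i, i ≤ 2 * n → expd n g i ≤ 2 * n := by
      intro i hi
      by_cases h1 : i = M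
      · rw [h1, e1]
      by_cases h2 : i = 2 * n
      · rw [h2, e2]; omega
      have := e3 i h1 h2
      have := e4 i (by omega) h1
      omega
    have ho : ∀ i, 2 * n < i → expd n g i = i := by
      intro i hi
      rw [e3 i (by omega) (by omega), h.out (by omega)]
    have hln : l ≤ 2 * n := by
      by_contra hcon
      have h4 := ho l (by omega)
      by_cases h5 : i ≤ 2 * n
      · have := hv i h5
        omega
      · have := ho i (by omega)
        omega
    have vj := hv j (by omega)
    have vi := hv i (by omega)
    have k1 : k ≠ M := fun e => by
      have := e1' k e
      have := hv k (by omega)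
      omega
    have i1 : i ≠ M := fun e => by
      have := e1' i e
      have := hv k (by omega)
      omega
    have l1 : l ≠ M := fun e => by
      have := e1' l e
      have := hv k (by omega)
      omega
    have hk := e3 k k1 (by omega)
    have hi := e3 i i1 (by omega)
    by_cases l2 : l = 2 * n
    · rw [l2, e2] at p1
      by_cases k2 : M < k
      · have := hafter k k2 (by omega)
        omega
      · have hj := e3 j (by omega) (by omega)
        exact h.a2431 (i := i) (j := j) (k := k) (l := M) hij hjk (by omega) (by omega)
          (by omega) (by omega)
    · have hl := e3 l l1 l2
      by_cases j1 : j = M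
      · have := hafter k (by omega) (by omega)
        exact h.a2431 hij hjk hkl (by omega) (by omega) (by rw [j1, hgM]; omega)
      · have hj := e3 j j1 (by omega)
        exact h.a2431 hij hjk hkl (by omega) (by omega) (by omega)
  · funext i
    unfold con
    rw [e2]
    split_ifs with q1 q2
    · rw [q1, hgM]
    · rw [q2, h.out le_rfl]
    · exact e3 i q1 q2
  · intro x hx
    rw [el] at hx ⊢
    rw [e3 x (by omega) (by omega)]
    exact hm3 x hx

/-- The two models agree. -/
def permEquiv (N : ℕ) : {π : Equiv.Perm (Fin N) //
      IsInvolution π ∧ IsRevAlternating π ∧ Avoids π p2431 ∧ Avoids π p4132} ≃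
      {f : ℕ → ℕ // Good N f} where
  toFun π := ⟨fun i => if h : i < N then (π.1 ⟨i, h⟩ : ℕ) else i, by
    obtain ⟨π, hinv, halt, hav, -⟩ := π
    have e1 : ∀ i (h : i < N), (if h : i < N then (π ⟨i, h⟩ : ℕ) else i) = π ⟨i, h⟩ := by
      intro i h; simp [h]
    have e2 : ∀ i, N ≤ i → (if h : i < N then (π ⟨i, h⟩ : ℕ) else i) = i := by
      intro i h; simp [not_lt.mpr h]
    refine ⟨?_, e2, ?_, ?_⟩
    · intro i
      dsimp only
      by_cases h : i < N
      · rw [e1 i h, e1 _ (π ⟨i, h⟩).2, Fin.eta, hinv]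
      · rw [e2 i (by omega), e2 i (by omega)]
    · intro i hi
      dsimp only
      rw [e1 i (by omega), e1 _ hi]
      have := halt ⟨i, by omega⟩ hi
      rw [Fin.lt_def] at this
      rw [this]
      simp only [Nat.odd_iff]
      omega
    · intro i j k l hij hjk hkl p1 p2 p3
      dsimp only at p1 p2 p3
      have hl : l < N := by
        by_contra hcon
        rw [e2 l (by omega)] at p1
        by_cases h : i < N
        · rw [e1 i h] at p1
          have := (π ⟨i, h⟩).2
          omega
        · rw [e2 i (by omega)] at p1
          omega
      rw [e1 i (by omega), e1 l hl] at p1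
      rw [e1 i (by omega), e1 k (by omega)] at p2
      rw [e1 j (by omega), e1 k (by omega)] at p3
      apply hav
      refine ⟨![⟨i, by omega⟩, ⟨j, by omega⟩, ⟨k, by omega⟩, ⟨l, hl⟩], ?_, ?_⟩
      · rw [Fin.strictMono_iff_lt_succ]
        intro a
        fin_cases a
        · exact hij
        · exact hjk
        · exact hkl
      · intro a b
        have q1 := Fin.lt_def.mpr p1
        have q2 := Fin.lt_def.mpr p2
        have q3 := Fin.lt_def.mpr p3
        fin_cases a <;> fin_cases b <;> simp [p2431] <;> order⟩
  invFun f := ⟨⟨fun i => ⟨f.1 i, f.2.lt i.2⟩, fun i => ⟨f.1 i, f.2.lt i.2⟩,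
      fun i => by ext; simp [f.2.inv], fun i => by ext; simp [f.2.inv]⟩, by
    obtain ⟨f, h⟩ := f
    refine ⟨?_, ?_, ?_, ?_⟩
    · intro i; ext; simp [h.inv]
    · intro i hi
      have := h.2.2.1 i hi
      simp only [Equiv.coe_fn_mk, Fin.lt_def, Nat.odd_iff]
      omega
    · rintro ⟨q, hq, hp⟩
      refine h.a2431 (i := q 0) (j := q 1) (k := q 2) (l := q 3) (hq (by decide)) (hq (by decide))
        (hq (by decide)) ?_ ?_ ?_
      · exact (hp 3 0).2 (by decide)
      · exact (hp 0 2).2 (by decide)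
      · exact (hp 2 1).2 (by decide)
    · rintro ⟨q, hq, hp⟩
      refine h.a4132 (i := q 0) (j := q 1) (k := q 2) (l := q 3) (hq (by decide)) (hq (by decide))
        (hq (by decide)) ?_ ?_ ?_
      · exact (hp 1 3).2 (by decide)
      · exact (hp 3 2).2 (by decide)
      · exact (hp 2 0).2 (by decide)⟩
  left_inv π := by
    ext i
    simp
  right_inv f := by
    ext i
    by_cases h : i < N
    · simp [h]
    · simp [h, f.2.out (not_lt.mp h)]

lemma finGood (N : ℕ) : {f : ℕ → ℕ | Good N f}.Finite :=
  Finite.of_equiv _ (permEquiv N)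

noncomputable def SF (N : ℕ) : Finset (ℕ → ℕ) := (finGood N).toFinset

lemma mem_SF {N : ℕ} {f : ℕ → ℕ} : f ∈ SF N ↔ Good N f := by simp [SF]

lemma card_SF (N : ℕ) : Nat.card {π : Equiv.Perm (Fin N) //
      IsInvolution π ∧ IsRevAlternating π ∧ Avoids π p2431 ∧ Avoids π p4132} = (SF N).card := by
  rw [Nat.card_congr (permEquiv N)]
  unfold SF
  rw [← Set.ncard_eq_toFinset_card _ (finGood N)]
  rfl

lemma card_fiber {m n : ℕ} (hmn : m < n) :
    ((SF (2 * n)).filter (fun f => f (2 * n - 1) / 2 = m)).card = (SF (2 * m)).card := by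
  have key : ∀ f, Good (2 * n) f → f (2 * n - 1) / 2 = m → f (2 * n - 1) = 2 * m ∧
      (∀ i, i < 2 * m → f i < 2 * m) ∧ ∀ i, 2 * m ≤ i → i < 2 * n → f i = blk m n i := by
    intro f hf e
    obtain ⟨m', h1, h2, h3, h4⟩ := hf.even1 (by omega)
    have : m' = m := by omega
    subst this
    exact ⟨h2, h3, even_blk hf h1 h2 h4⟩
  apply Finset.card_nbij' (cut m) (extB m n)
  · intro f hf
    simp only [Finset.coe_filter, Set.mem_ofPred_eq, mem_SF] at hf
    simp only [Finset.mem_coe, mem_SF]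
    exact good_cut hmn hf.1 (key f hf.1 hf.2).2.1
  · intro g hg
    simp only [Finset.mem_coe, mem_SF] at hg
    simp only [Finset.coe_filter, Set.mem_ofPred_eq, mem_SF]
    refine ⟨good_extB hmn hg, ?_⟩
    unfold extB blk
    split_ifs <;> omega
  · intro f hf
    simp only [Finset.coe_filter, Set.mem_ofPred_eq, mem_SF] at hf
    have hk := key f hf.1 hf.2
    funext i
    unfold extB cut
    split_ifs with h1 h2
    · rfl
    · exact (hk.2.2 i (by omega) h2).symm
    · exact (hf.1.out (by omega)).symm
  · intro g hg
    simp only [Finset.mem_coe, mem_SF] at hg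
    funext i
    unfold cut extB
    split_ifs with h1
    · rfl
    · exact (hg.out (by omega)).symm

lemma last_lt {n : ℕ} (hn : 1 ≤ n) {f : ℕ → ℕ} (hf : Good (2 * n) f) :
    f (2 * n - 1) / 2 < n := by
  obtain ⟨m', h1, h2, h3, h4⟩ := hf.even1 hn
  omega

lemma card_even_rec {n : ℕ} (hn : 1 ≤ n) :
    (SF (2 * n)).card = ∑ m ∈ Finset.range n, (SF (2 * m)).card := by
  rw [Finset.card_eq_sum_card_fiberwise (f := fun f => f (2 * n - 1) / 2) (t := Finset.range n)]
  · exact Finset.sum_congr rfl fun m hm => card_fiber (Finset.mem_range.mp hm)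
  · intro f hf
    simp only [Finset.mem_coe, mem_SF] at hf
    simpa using last_lt hn hf

noncomputable def GF (n : ℕ) : Finset (ℕ → ℕ) :=
  (SF (2 * n)).filter (fun f => (n - f (2 * n - 1) / 2) % 2 = 0)

lemma card_GF {n : ℕ} (hn : 1 ≤ n) :
    (GF n).card = ∑ m ∈ Finset.range n, if (n - m) % 2 = 0 then (SF (2 * m)).card else 0 := by
  rw [Finset.card_eq_sum_card_fiberwise (f := fun f => f (2 * n - 1) / 2) (t := Finset.range n)]
  · refine Finset.sum_congr rfl fun m hm => ?_
    split_ifs with h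
    · rw [← card_fiber (Finset.mem_range.mp hm)]
      congr 1
      ext f
      simp only [GF, Finset.mem_filter]
      constructor
      · rintro ⟨⟨a, b⟩, c⟩; exact ⟨a, c⟩
      · rintro ⟨a, c⟩; exact ⟨⟨a, by rwa [c]⟩, c⟩
    · rw [Finset.card_eq_zero, Finset.filter_eq_empty_iff]
      intro f hf e
      simp only [GF, Finset.mem_filter] at hf
      rw [e] at hf
      exact h hf.2
  · intro f hf
    simp only [GF, Finset.coe_filter, Set.mem_ofPred_eq, mem_SF] at hf
    simpa using last_lt hn hf.1

lemma card_SF_zero : (SF 0).card = 1 := by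
  rw [Finset.card_eq_one]
  refine ⟨id, ?_⟩
  ext f
  rw [mem_SF, Finset.mem_singleton]
  constructor
  · intro h; funext i; exact h.out (Nat.zero_le _)
  · rintro rfl
    refine ⟨fun _ => rfl, fun _ _ => rfl, fun i hi => by omega, ?_⟩
    intro i j k l h1 h2 h3 h4 h5 h6
    simp only [id] at *
    omega

lemma sum_even (n : ℕ) : ∑ m ∈ Finset.range (n + 1), (SF (2 * m)).card = 2 ^ n := by
  induction n with
  | zero => simp [card_SF_zero]
  | succ n ih =>
    rw [Finset.sum_range_succ, ih, card_even_rec (by omega), ih]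
    ring

lemma card_even (n : ℕ) : (SF (2 * (n + 1))).card = 2 ^ n := by
  rw [card_even_rec (by omega), sum_even]

lemma card_GF_add (n : ℕ) : (GF (n + 2)).card + (GF (n + 1)).card = 2 ^ n := by
  rw [card_GF (by omega), card_GF (by omega), Finset.sum_range_succ,
    show n + 2 - (n + 1) = 1 by omega, if_neg (by omega), add_zero, ← Finset.sum_add_distrib,
    ← sum_even]
  refine Finset.sum_congr rfl fun m hm => ?_
  rw [Finset.mem_range] at hm
  split_ifs <;> omega

lemma card_GF_one : (GF 1).card = 0 := by
  rw [card_GF le_rfl]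
  simp

noncomputable def BF (n : ℕ) : Finset (ℕ → ℕ) :=
  (SF (2 * n + 1)).filter (fun f => f (2 * n) ≠ 2 * n)

lemma card_odd {n : ℕ} (hn : 1 ≤ n) :
    (SF (2 * n + 1)).card = (SF (2 * n)).card + (BF n).card := by
  rw [← Finset.card_filter_add_card_filter_not (s := SF (2 * n + 1)) (fun f => f (2 * n) = 2 * n)]
  congr 1
  congr 1
  ext f
  rw [Finset.mem_filter, mem_SF, mem_SF]
  constructor
  · rintro ⟨h, e⟩
    refine ⟨h.1, ?_, fun i hi => h.2.2.1 i (by omega), h.2.2.2⟩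
    intro i hi
    rcases eq_or_lt_of_le hi with h1 | h1
    · rw [← h1, e]
    · exact h.out h1
  · intro h
    refine ⟨⟨h.1, fun i hi => h.out (by omega), ?_, h.2.2.2⟩, h.out le_rfl⟩
    intro i hi
    by_cases h1 : i + 1 < 2 * n
    · exact h.2.2.1 i h1
    · have h2 := h.lt (i := i) (by omega)
      have h3 := h.out (i := i + 1) (by omega)
      omega

lemma card_BF_zero : (BF 0).card = 0 := by
  rw [Finset.card_eq_zero, BF, Finset.filter_eq_empty_iff]
  intro f hf
  rw [mem_SF] at hf
  have := hf.lt (i := 0) (by omega)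
  simp only [ne_eq, not_not, Nat.mul_zero]
  omega

lemma card_BF_succ (k : ℕ) : (BF (k + 1)).card = (BF k).card + (GF (k + 1)).card := by
  classical
  have e1 : 2 * (k + 1) - 1 = 2 * k + 1 := by omega
  have e2 : 2 * (k + 1) - 2 = 2 * k := by omega
  have memB : ∀ n f, f ∈ BF n ↔ Good (2 * n + 1) f ∧ f (2 * n) ≠ 2 * n := by
    intro n f; simp [BF, mem_SF]
  have memB' : ∀ f, f ∈ BF k ↔
      Good (2 * (k + 1) - 1) f ∧ f (2 * (k + 1) - 2) ≠ 2 * (k + 1) - 2 := by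
    intro f; rw [memB, e1, e2]
  have memG : ∀ f, f ∈ GF (k + 1) ↔ Good (2 * (k + 1)) f ∧
      ((k + 1) - f (2 * (k + 1) - 1) / 2) % 2 = 0 := by
    intro f; simp [GF, mem_SF]
  have hU : BF (k + 1) = (BF k).image (lng (k + 1)) ∪ (GF (k + 1)).image (expd (k + 1)) := by
    ext f
    simp only [Finset.mem_union, Finset.mem_image]
    constructor
    · intro hf
      rw [memB] at hf
      obtain ⟨h, hne⟩ := hf
      by_cases hx : ∃ x, x < f (2 * (k + 1) - 1) ∧ f (2 * (k + 1) - 1) < f x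
      · obtain ⟨x, hx1, hx2⟩ := hx
        left
        obtain ⟨h1, h2, h3⟩ := odd_cross h hne hx1 hx2
        obtain ⟨M, c, hM, hfM, hc, hfc, hMe, hce, -⟩ := odd_basic h hne
        refine ⟨shr (k + 1) f, ?_, lng_shr h h1 h3⟩
        rw [memB']
        refine ⟨good_shr h h1 h2 h3 (by rw [hc]; exact hce), ?_⟩
        unfold shr
        split_ifs <;> omega
      · right
        push Not at hx
        obtain ⟨h1, h2, h3, h4⟩ := good_con h hne hx
        exact ⟨con (k + 1) f, (memG _).2 ⟨h1, by rwa [h2]⟩, h4⟩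
    · rintro (⟨g, hg, rfl⟩ | ⟨g, hg, rfl⟩)
      · rw [memB'] at hg
        rw [memB]
        refine ⟨good_lng hg.1 (by omega) hg.2, ?_⟩
        have := hg.1.lt (i := 2 * (k + 1) - 2) (by omega)
        unfold lng
        split_ifs <;> omega
      · rw [memG] at hg
        obtain ⟨h1, h2, -⟩ := expd_spec hg.1 (by omega) hg.2
        exact (memB _ _).2 ⟨h1, h2⟩
  have hD : Disjoint ((BF k).image (lng (k + 1))) ((GF (k + 1)).image (expd (k + 1))) := by
    rw [Finset.disjoint_left]
    intro f hf hf'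
    rw [Finset.mem_image] at hf hf'
    obtain ⟨g, hg, rfl⟩ := hf
    obtain ⟨g', hg', e⟩ := hf'
    rw [memG] at hg'
    have hns := (expd_spec hg'.1 (by omega) hg'.2).2.2.2
    rw [e] at hns
    rw [memB] at hg
    obtain ⟨M, c, hM, hfM, hc, hfc, hMe, hce, hcM, hMl, -⟩ := odd_basic hg.1 hg.2
    have a1 : lng (k + 1) g (2 * (k + 1) - 1) = M := by
      unfold lng
      rw [e2, e1, hM, if_neg (by omega), if_pos rfl]
    have a2 : lng (k + 1) g c = 2 * k - 1 := by
      unfold lng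
      rw [e2, e1, hM, if_neg (by omega), if_neg (by omega), if_neg (by omega), if_neg (by omega), hfc]
    have := hns c (by omega)
    omega
  rw [hU, Finset.card_union_of_disjoint hD, Finset.card_image_of_injOn, Finset.card_image_of_injOn]
  · intro g hg g' hg' e
    rw [Finset.mem_coe, memG] at hg hg'
    rw [← (expd_spec hg.1 (by omega) hg.2).2.2.1, e, (expd_spec hg'.1 (by omega) hg'.2).2.2.1]
  · intro g hg g' hg' e
    rw [Finset.mem_coe, memB'] at hg hg'
    exact lng_inj hg.1 hg'.1 (by omega) hg.2 hg'.2 e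

lemma card_BF (n : ℕ) : (BF n).card = 2 ^ n / 3 ∧ (BF (n + 1)).card = 2 ^ (n + 1) / 3 := by
  induction n with
  | zero =>
    rw [card_BF_succ, card_BF_zero, card_GF_one]
    simp
  | succ n ih =>
    refine ⟨ih.2, ?_⟩
    have h1 := card_BF_succ (n + 1)
    have h2 := card_BF_succ n
    have h3 := card_GF_add n
    have h4 : 2 ^ (n + 1 + 1) = 4 * 2 ^ n := by ring
    have h5 : 2 ^ (n + 1) = 2 * 2 ^ n := by ring
    have := ih.1
    have := ih.2
    rw [show n + 2 = n + 1 + 1 from rfl] at h3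
    omega

/-- For n ≥ 1, the number of reverse alternating involutions of length 2n+1
avoiding both 2431 and 4132 is ⌊5·2^{n-1}/3⌋. -/
theorem card_RAI_odd_avoiding_2431_4132 (n : ℕ) (hn : 1 ≤ n) :
    Nat.card {π : Equiv.Perm (Fin (2 * n + 1)) //
      IsInvolution π ∧ IsRevAlternating π ∧ Avoids π p2431 ∧ Avoids π p4132} =
    5 * 2 ^ (n - 1) / 3 := by
  obtain ⟨k, rfl⟩ : ∃ k, n = k + 1 := ⟨n - 1, by omega⟩
  rw [card_SF, card_odd hn, card_even, (card_BF k).2, Nat.add_sub_cancel, pow_succ]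
  omega
end
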